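/- (Spectral gap of the nearest-neighbor dynamics.) For every B > 0 there exists a constant C = C(B) < ∞ such that for every cube Λ_L ⊂ ℤ^d of side length L, every field α : Λ_L → [−B, B], every integer 0 ≤ N ≤ L^d, and every function f : {0,1}^{Λ_L} → ℝ, Var_{Λ_L,N}(f) ≤ C L² E_{Λ_L,N}[ Σ_{x,y∈Λ_L, |x−y|=1} (∇_{xy} f)² ], where Var_{Λ_L,N} and E_{Λ_L,N} denote the variance and expectation with respect to the canonical measure. -/

import Mathlib

noncomputable section

/-- `T_{xy}η`: the configuration (given by its set of occupied sites) with the occupation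
numbers at `x` and `y` exchanged. -/
def exchV {V : Type*} [DecidableEq V] (x y : V) (S : Finset V) : Finset V :=
  S.image (Equiv.swap x y)

/-- `∇_{xy} f (η) = f(T_{xy}η) - f(η)`. -/
def gradV {V : Type*} [DecidableEq V] (x y : V) (f : Finset V → ℝ) (S : Finset V) : ℝ :=
  f (exchV x y S) - f S

/-- Expectation with respect to the canonical measure on `{0,1}^Λ` with field `α` and `N`
particles: a configuration `S ⊆ Λ` with `|S| = N` has weight proportional to
`exp(∑_{x ∈ S} α_x)`. -/
def cE {V : Type*} [DecidableEq V] (Λ : Finset V) (α : V → ℝ) (N : ℕ)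
    (g : Finset V → ℝ) : ℝ :=
  (∑ S ∈ Λ.powersetCard N, Real.exp (∑ x ∈ S, α x) * g S) /
    ∑ S ∈ Λ.powersetCard N, Real.exp (∑ x ∈ S, α x)

/-- Variance with respect to the canonical measure. -/
def cVar {V : Type*} [DecidableEq V] (Λ : Finset V) (α : V → ℝ) (N : ℕ)
    (f : Finset V → ℝ) : ℝ :=
  cE Λ α N fun S => (f S - cE Λ α N f) ^ 2

/-- The cube of side length `L` in `ℤ^d` with corner `v`. -/
def cube (d : ℕ) (v : Fin d → ℤ) (L : ℕ) : Finset (Fin d → ℤ) :=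
  Fintype.piFinset fun i => Finset.Ico (v i) (v i + L)

section ExchangeBasics

variable {V : Type*} [DecidableEq V]

theorem mem_exchV {x y z : V} {S : Finset V} :
    z ∈ exchV x y S ↔ Equiv.swap x y z ∈ S := by
  unfold exchV
  rw [Finset.mem_image]
  constructor
  · rintro ⟨a, ha, rfl⟩
    simpa using ha
  · intro h
    exact ⟨_, h, by simp⟩

theorem exchV_comm (x y : V) (S : Finset V) : exchV x y S = exchV y x S := by
  unfold exchV
  rw [Equiv.swap_comm]

theorem exchV_exchV (x y : V) (S : Finset V) : exchV x y (exchV x y S) = S := by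
  ext z
  simp [mem_exchV]

theorem exchV_self (x : V) (S : Finset V) : exchV x x S = S := by
  ext z
  simp [mem_exchV]

theorem exchV_mem_powersetCard {Λ : Finset V} {N : ℕ} {x y : V} (hx : x ∈ Λ) (hy : y ∈ Λ)
    {S : Finset V} (hS : S ∈ Λ.powersetCard N) : exchV x y S ∈ Λ.powersetCard N := by
  rw [Finset.mem_powersetCard] at hS ⊢
  refine ⟨fun z hz => ?_, ?_⟩
  · rw [mem_exchV] at hz
    have h := hS.1 hz
    by_cases h1 : z = x
    · rwa [h1]
    by_cases h2 : z = y
    · rwa [h2]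
    rwa [Equiv.swap_apply_of_ne_of_ne h1 h2] at h
  · unfold exchV
    rw [Finset.card_image_of_injective _ (Equiv.injective _)]
    exact hS.2

theorem sum_exchV {Λ : Finset V} {N : ℕ} {x y : V} (hx : x ∈ Λ) (hy : y ∈ Λ)
    (F : Finset V → ℝ) :
    ∑ S ∈ Λ.powersetCard N, F (exchV x y S) = ∑ S ∈ Λ.powersetCard N, F S :=
  Finset.sum_nbij' (exchV x y) (exchV x y) (fun _ h => exchV_mem_powersetCard hx hy h)
    (fun _ h => exchV_mem_powersetCard hx hy h) (fun _ _ => exchV_exchV _ _ _)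
    (fun _ _ => exchV_exchV _ _ _) (fun _ _ => rfl)

theorem exchV_conj {x y z : V} (hxy : x ≠ y) (hyz : y ≠ z) (hxz : x ≠ z) (S : Finset V) :
    exchV x z S = exchV x y (exchV y z (exchV x y S)) := by
  ext t
  simp only [mem_exchV]
  have h : (Equiv.swap x y) ((Equiv.swap y z) ((Equiv.swap x y) t)) = Equiv.swap x z t := by
    grind
  rw [h]

/-- The unnormalised Dirichlet term of the exchange of `x` and `y`, with weight `ρ`. -/
def exchForm (Λ : Finset V) (N : ℕ) (ρ f : Finset V → ℝ) (x y : V) : ℝ :=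
  ∑ S ∈ Λ.powersetCard N, ρ S * gradV x y f S ^ 2

theorem exchForm_comm (Λ : Finset V) (N : ℕ) (ρ f : Finset V → ℝ) (x y : V) :
    exchForm Λ N ρ f x y = exchForm Λ N ρ f y x := by
  simp only [exchForm, gradV, exchV_comm x y]

theorem exchForm_self (Λ : Finset V) (N : ℕ) (ρ f : Finset V → ℝ) (x : V) :
    exchForm Λ N ρ f x x = 0 := by
  simp [exchForm, gradV, exchV_self]

theorem exchForm_nonneg (Λ : Finset V) (N : ℕ) (ρ f : Finset V → ℝ) (x y : V)
    (hρ : ∀ S ∈ Λ.powersetCard N, 0 ≤ ρ S) : 0 ≤ exchForm Λ N ρ f x y :=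
  Finset.sum_nonneg fun S hS => mul_nonneg (hρ S hS) (sq_nonneg _)

theorem sum_comp_exchV_le {Λ : Finset V} {N : ℕ} {x y : V} (hx : x ∈ Λ) (hy : y ∈ Λ)
    {ρ h : Finset V → ℝ} {Q : ℝ} (hQ : ∀ S ∈ Λ.powersetCard N, ρ (exchV x y S) ≤ Q * ρ S)
    (hh : ∀ S, 0 ≤ h S) :
    ∑ S ∈ Λ.powersetCard N, ρ S * h (exchV x y S) ≤ Q * ∑ S ∈ Λ.powersetCard N, ρ S * h S := by
  rw [← sum_exchV hx hy, Finset.mul_sum]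
  refine Finset.sum_le_sum fun S hS => ?_
  rw [exchV_exchV, ← mul_assoc]
  exact mul_le_mul_of_nonneg_right (hQ S hS) (hh S)

/-- A weighted quasi-triangle inequality for exchange forms. -/
theorem exchForm_triangle {Λ : Finset V} {N : ℕ} {x y z : V} (hx : x ∈ Λ) (hy : y ∈ Λ)
    (hz : z ∈ Λ) {ρ : Finset V → ℝ} (f : Finset V → ℝ) {Q r : ℝ} (hQ1 : 1 ≤ Q) (hr : 0 < r)
    (hρ : ∀ S ∈ Λ.powersetCard N, 0 ≤ ρ S)
    (hxy : ∀ S ∈ Λ.powersetCard N, ρ (exchV x y S) ≤ Q * ρ S)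
    (hyz : ∀ S ∈ Λ.powersetCard N, ρ (exchV y z S) ≤ Q * ρ S) :
    exchForm Λ N ρ f x z ≤
      (r + 1) * (2 * (Q ^ 2 + 1) * exchForm Λ N ρ f x y + Q * exchForm Λ N ρ f y z / r) := by
  have n1 := exchForm_nonneg Λ N ρ f x y hρ
  have n2 := exchForm_nonneg Λ N ρ f y z hρ
  have hrr : exchForm Λ N ρ f y z ≤ (r + 1) * (Q * exchForm Λ N ρ f y z / r) := by
    rw [mul_div_assoc', le_div_iff₀ hr]
    nlinarith [mul_nonneg hr.le n2, mul_nonneg (sub_nonneg.2 hQ1) n2,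
      mul_nonneg (mul_nonneg (sub_nonneg.2 hQ1) n2) hr.le]
  by_cases exz : x = z
  · subst exz
    rw [exchForm_self]
    have hQ0 : 0 ≤ Q := by linarith
    positivity
  by_cases exy : x = y
  · subst exy
    rw [exchForm_self]
    simpa using hrr
  by_cases eyz : y = z
  · subst eyz
    rw [exchForm_self, mul_zero, zero_div, add_zero]
    nlinarith [mul_nonneg hr.le n1, mul_nonneg (sq_nonneg Q) n1,
      mul_nonneg hr.le (mul_nonneg (sq_nonneg Q) n1)]
  have key : ∀ S, gradV x z f S = gradV x y f (exchV y z (exchV x y S)) +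
      gradV y z f (exchV x y S) + gradV x y f S := by
    intro S
    simp only [gradV]
    rw [← exchV_conj exy eyz exz]
    ring
  have h1 : ∑ S ∈ Λ.powersetCard N, ρ S * gradV y z f (exchV x y S) ^ 2 ≤
      Q * exchForm Λ N ρ f y z :=
    sum_comp_exchV_le (h := fun S => gradV y z f S ^ 2) hx hy hxy fun S => sq_nonneg _
  have h2 : ∑ S ∈ Λ.powersetCard N, ρ S * gradV x y f (exchV y z (exchV x y S)) ^ 2 ≤
      Q * (Q * exchForm Λ N ρ f x y) := by
    refine (sum_comp_exchV_le (h := fun S => gradV x y f (exchV y z S) ^ 2) hx hy hxy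
      fun S => sq_nonneg _).trans ?_
    refine mul_le_mul_of_nonneg_left ?_ (by linarith)
    exact sum_comp_exchV_le (h := fun S => gradV x y f S ^ 2) hy hz hyz fun S => sq_nonneg _
  have h0 : exchForm Λ N ρ f x z ≤ (r + 1) *
      (2 * ∑ S ∈ Λ.powersetCard N, ρ S * gradV x y f (exchV y z (exchV x y S)) ^ 2 +
      2 * exchForm Λ N ρ f x y +
      (∑ S ∈ Λ.powersetCard N, ρ S * gradV y z f (exchV x y S) ^ 2) / r) := by
    unfold exchForm
    rw [Finset.mul_sum, Finset.mul_sum, Finset.sum_div, ← Finset.sum_add_distrib,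
      ← Finset.sum_add_distrib, Finset.mul_sum]
    refine Finset.sum_le_sum fun S hS => ?_
    rw [key S]
    generalize gradV x y f (exchV y z (exchV x y S)) = a
    generalize gradV y z f (exchV x y S) = b
    generalize gradV x y f S = c
    have hpt : (a + b + c) ^ 2 ≤ (r + 1) * (2 * a ^ 2 + 2 * c ^ 2 + b ^ 2 / r) := by
      have e : (r + 1) * (2 * a ^ 2 + 2 * c ^ 2 + b ^ 2 / r) - (a + b + c) ^ 2 =
          (r + 1) * (a - c) ^ 2 + (r * (a + c) - b) ^ 2 / r := by
        field_simp
        ring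
      have : 0 ≤ (r + 1) * (a - c) ^ 2 + (r * (a + c) - b) ^ 2 / r := by positivity
      linarith
    calc ρ S * (a + b + c) ^ 2 ≤ ρ S * ((r + 1) * (2 * a ^ 2 + 2 * c ^ 2 + b ^ 2 / r)) :=
          mul_le_mul_of_nonneg_left hpt (hρ S hS)
      _ = _ := by ring
  refine h0.trans ?_
  refine mul_le_mul_of_nonneg_left ?_ (by linarith)
  have := div_le_div_of_nonneg_right h1 hr.le
  nlinarith

/-- The unnormalised canonical weight of a configuration. -/
def canWeight (α : V → ℝ) (S : Finset V) : ℝ := Real.exp (∑ x ∈ S, α x)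

omit [DecidableEq V] in
theorem canWeight_pos (α : V → ℝ) (S : Finset V) : 0 < canWeight α S := Real.exp_pos _

theorem exchV_eq_self_or (x y : V) (S : Finset V) :
    exchV x y S = S ∨ (x ∈ S ∧ y ∉ S ∧ exchV x y S = insert y (S.erase x)) ∨
      (y ∈ S ∧ x ∉ S ∧ exchV x y S = insert x (S.erase y)) := by
  by_cases hx : x ∈ S <;> by_cases hy : y ∈ S
  · left
    ext z
    rw [mem_exchV, Equiv.swap_apply_def]
    split_ifs <;> simp_all
  · right; left
    refine ⟨hx, hy, ?_⟩
    ext z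
    rw [mem_exchV, Equiv.swap_apply_def, Finset.mem_insert, Finset.mem_erase]
    split_ifs <;> grind
  · right; right
    refine ⟨hy, hx, ?_⟩
    ext z
    rw [mem_exchV, Equiv.swap_apply_def, Finset.mem_insert, Finset.mem_erase]
    split_ifs <;> grind
  · left
    ext z
    rw [mem_exchV, Equiv.swap_apply_def]
    split_ifs <;> simp_all

theorem canWeight_insert (α : V → ℝ) {S : Finset V} {y : V} (hy : y ∉ S) :
    canWeight α (insert y S) = Real.exp (α y) * canWeight α S := by
  unfold canWeight
  rw [Finset.sum_insert hy, Real.exp_add]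

theorem canWeight_exchV_le {α : V → ℝ} {B : ℝ} {x y : V} (hx : |α x| ≤ B) (hy : |α y| ≤ B)
    (S : Finset V) : canWeight α (exchV x y S) ≤ Real.exp (2 * B) * canWeight α S := by
  have hB : 0 ≤ B := (abs_nonneg _).trans hx
  rw [abs_le] at hx hy
  have aux : ∀ a b : V, (α a - α b ≤ 2 * B) → b ∈ S → a ∉ S →
      canWeight α (insert a (S.erase b)) ≤ Real.exp (2 * B) * canWeight α S := by
    intro a b hab hb ha
    unfold canWeight
    rw [← Real.exp_add, Real.exp_le_exp, Finset.sum_insert (fun h => ha (Finset.mem_of_mem_erase h)),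
      ← Finset.add_sum_erase S α hb]
    linarith
  rcases exchV_eq_self_or x y S with h | ⟨h1, h2, h⟩ | ⟨h1, h2, h⟩ <;> rw [h]
  · have := Real.one_le_exp (x := 2 * B) (by linarith)
    nlinarith [canWeight_pos α S]
  · exact aux y x (by linarith) h1 h2
  · exact aux x y (by linarith) h1 h2

theorem exchForm_canWeight_triangle {Λ : Finset V} {N : ℕ} {α : V → ℝ} {B : ℝ} (hB : 0 ≤ B)
    (hα : ∀ x ∈ Λ, |α x| ≤ B) (f : Finset V → ℝ)
    {x y z : V} (hx : x ∈ Λ) (hy : y ∈ Λ) (hz : z ∈ Λ) :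
    exchForm Λ N (canWeight α) f x z ≤ 8 * Real.exp (4 * B) *
      (exchForm Λ N (canWeight α) f x y + exchForm Λ N (canWeight α) f y z) := by
  have h := exchForm_triangle (N := N) hx hy hz f (Q := Real.exp (2 * B)) (r := 1)
    (ρ := canWeight α)
    (Real.one_le_exp (by linarith)) one_pos (fun S _ => (canWeight_pos α S).le)
    (fun S _ => canWeight_exchV_le (hα x hx) (hα y hy) S)
    (fun S _ => canWeight_exchV_le (hα y hy) (hα z hz) S)
  have e : Real.exp (4 * B) = Real.exp (2 * B) ^ 2 := by
    rw [← Real.exp_nat_mul]; congr 1; push_cast; ring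
  have h1 : 1 ≤ Real.exp (2 * B) := Real.one_le_exp (by linarith)
  have n1 := exchForm_nonneg Λ N (canWeight α) f x y (fun S _ => (canWeight_pos α S).le)
  have n2 := exchForm_nonneg Λ N (canWeight α) f y z (fun S _ => (canWeight_pos α S).le)
  refine h.trans ?_
  rw [e]
  generalize Real.exp (2 * B) = Q at *
  have hq : 1 ≤ Q ^ 2 := by nlinarith
  have hq2 : Q ≤ Q ^ 2 := by nlinarith
  rw [div_one]
  nlinarith [mul_le_mul_of_nonneg_right hq n1, mul_le_mul_of_nonneg_right hq2 n2,
    mul_nonneg (sq_nonneg Q) n2]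

end ExchangeBasics

section DownUpWalk

variable {V : Type*} [DecidableEq V]

theorem sum_powersetCard_succ_erase (Λ : Finset V) (n : ℕ) (F : Finset V → V → ℝ) :
    ∑ S ∈ Λ.powersetCard (n + 1), ∑ x ∈ S, F (S.erase x) x =
      ∑ T ∈ Λ.powersetCard n, ∑ y ∈ Λ \ T, F T y := by
  rw [Finset.sum_sigma', Finset.sum_sigma']
  refine Finset.sum_bij' (fun p _ => ⟨p.1.erase p.2, p.2⟩) (fun p _ => ⟨insert p.2 p.1, p.2⟩)
    ?_ ?_ ?_ ?_ ?_
  · rintro ⟨S, x⟩ h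
    simp only [Finset.mem_sigma, Finset.mem_powersetCard, Finset.mem_sdiff] at h ⊢
    obtain ⟨⟨h1, h2⟩, h3⟩ := h
    refine ⟨⟨(Finset.erase_subset _ _).trans h1, ?_⟩, h1 h3, Finset.notMem_erase _ _⟩
    rw [Finset.card_erase_of_mem h3, h2]
    rfl
  · rintro ⟨T, y⟩ h
    simp only [Finset.mem_sigma, Finset.mem_powersetCard, Finset.mem_sdiff] at h ⊢
    obtain ⟨⟨h1, h2⟩, h3, h4⟩ := h
    refine ⟨⟨Finset.insert_subset h3 h1, ?_⟩, Finset.mem_insert_self _ _⟩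
    rw [Finset.card_insert_of_notMem h4, h2]
  · rintro ⟨S, x⟩ h
    simp only [Finset.mem_sigma] at h
    simp [Finset.insert_erase h.2]
  · rintro ⟨T, y⟩ h
    simp only [Finset.mem_sigma, Finset.mem_sdiff] at h
    simp [Finset.erase_insert h.2.2]
  · rintro ⟨S, x⟩ h
    rfl

theorem sum_canWeight_succ (Λ : Finset V) (α : V → ℝ) (n : ℕ)
    (G : Finset V → Finset V → V → ℝ) :
    ∑ S ∈ Λ.powersetCard (n + 1), canWeight α S * ∑ x ∈ S, G S (S.erase x) x =
      ∑ T ∈ Λ.powersetCard n, canWeight α T *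
        ∑ y ∈ Λ \ T, Real.exp (α y) * G (insert y T) T y := by
  have h := sum_powersetCard_succ_erase Λ n
    (fun T y => canWeight α T * (Real.exp (α y) * G (insert y T) T y))
  simp only [Finset.mul_sum] at h ⊢
  rw [← h]
  refine Finset.sum_congr rfl fun S _ => Finset.sum_congr rfl fun x hx => ?_
  rw [Finset.insert_erase hx]
  conv_lhs => rw [← Finset.insert_erase hx, canWeight_insert α (Finset.notMem_erase x S),
    Finset.insert_erase hx]
  ring

/-- The total weight of the sites which can be added to `T`. -/
def upMass (Λ : Finset V) (α : V → ℝ) (T : Finset V) : ℝ := ∑ y ∈ Λ \ T, Real.exp (α y)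

/-- The average of `f` after adding a site to `T` with probability proportional to its weight. -/
def upAvg (Λ : Finset V) (α : V → ℝ) (f : Finset V → ℝ) (T : Finset V) : ℝ :=
  (∑ y ∈ Λ \ T, Real.exp (α y) * f (insert y T)) / upMass Λ α T

/-- The Markov operator of the down-up walk on configurations with `n + 1` particles. -/
def downUp (Λ : Finset V) (α : V → ℝ) (n : ℕ) (f : Finset V → ℝ) (S : Finset V) : ℝ :=
  (∑ x ∈ S, upAvg Λ α f (S.erase x)) / (n + 1)

theorem upMass_pos {Λ : Finset V} (α : V → ℝ) {n : ℕ} (hn : n < Λ.card) {T : Finset V}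
    (hT : T ∈ Λ.powersetCard n) : 0 < upMass Λ α T := by
  rw [Finset.mem_powersetCard] at hT
  refine Finset.sum_pos (fun y _ => Real.exp_pos _) ?_
  rw [← Finset.card_pos, Finset.card_sdiff_of_subset hT.1]
  omega

theorem sum_canWeight_mul_downUp {Λ : Finset V} (α : V → ℝ) {n : ℕ} (hn : n < Λ.card)
    (f g : Finset V → ℝ) :
    ∑ S ∈ Λ.powersetCard (n + 1), canWeight α S * (g S * downUp Λ α n f S) =
      (∑ T ∈ Λ.powersetCard n, canWeight α T * (upMass Λ α T * (upAvg Λ α g T * upAvg Λ α f T))) /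
        (n + 1) := by
  have h := sum_canWeight_succ Λ α n (fun S T _ => g S * upAvg Λ α f T)
  rw [eq_div_iff (by positivity), Finset.sum_mul]
  calc _ = _ := ?_
    _ = _ := h
    _ = _ := ?_
  · refine Finset.sum_congr rfl fun S _ => ?_
    unfold downUp
    rw [← Finset.mul_sum]
    field_simp
  · refine Finset.sum_congr rfl fun T hT => ?_
    have hp := (upMass_pos α hn hT).ne'
    congr 1
    simp only [← mul_assoc, ← Finset.sum_mul]
    congr 1
    rw [upAvg]
    field_simp

theorem sum_canWeight_downUp_symm {Λ : Finset V} (α : V → ℝ) {n : ℕ} (hn : n < Λ.card)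
    (f g : Finset V → ℝ) :
    ∑ S ∈ Λ.powersetCard (n + 1), canWeight α S * (g S * downUp Λ α n f S) =
      ∑ S ∈ Λ.powersetCard (n + 1), canWeight α S * (downUp Λ α n g S * f S) := by
  simp only [mul_comm (downUp Λ α n g _), sum_canWeight_mul_downUp α hn]
  simp only [mul_comm (upAvg Λ α g _)]

theorem downUp_one {Λ : Finset V} (α : V → ℝ) {n : ℕ} (hn : n < Λ.card) {S : Finset V}
    (hS : S ∈ Λ.powersetCard (n + 1)) : downUp Λ α n (fun _ => 1) S = 1 := by
  have hS' := Finset.mem_powersetCard.1 hS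
  have h : ∀ x ∈ S, upAvg Λ α (fun _ => 1) (S.erase x) = 1 := by
    intro x hx
    have hT : S.erase x ∈ Λ.powersetCard n := by
      rw [Finset.mem_powersetCard]
      refine ⟨(Finset.erase_subset _ _).trans hS'.1, ?_⟩
      rw [Finset.card_erase_of_mem hx, hS'.2]
      rfl
    have := (upMass_pos α hn hT).ne'
    unfold upAvg
    simp only [mul_one]
    exact div_self this
  unfold downUp
  rw [Finset.sum_congr rfl h]
  simp only [Finset.sum_const, hS'.2, nsmul_eq_mul, mul_one]
  push_cast
  exact div_self (by positivity)

theorem sum_canWeight_downUp {Λ : Finset V} (α : V → ℝ) {n : ℕ} (hn : n < Λ.card)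
    (f : Finset V → ℝ) :
    ∑ S ∈ Λ.powersetCard (n + 1), canWeight α S * downUp Λ α n f S =
      ∑ S ∈ Λ.powersetCard (n + 1), canWeight α S * f S := by
  have h := sum_canWeight_downUp_symm α hn f (fun _ => 1)
  simp only [one_mul] at h
  rw [h]
  refine Finset.sum_congr rfl fun S hS => ?_
  rw [downUp_one α hn hS, one_mul]

omit [DecidableEq V] in
theorem sum_mul_sum_mul_sub_sq (s : Finset V) (w g : V → ℝ) :
    ∑ y ∈ s, ∑ z ∈ s, w y * w z * (g y - g z) ^ 2 =
      2 * ((∑ y ∈ s, w y) * ∑ y ∈ s, w y * g y ^ 2 - (∑ y ∈ s, w y * g y) ^ 2) := by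
  have e : ∀ y z, w y * w z * (g y - g z) ^ 2 =
      (w y * g y ^ 2) * w z + w y * (w z * g z ^ 2) - 2 * ((w y * g y) * (w z * g z)) := by
    intro y z; ring
  simp only [e, Finset.sum_sub_distrib, Finset.sum_add_distrib, ← Finset.mul_sum, ← Finset.sum_mul]
  ring

theorem insert_exchV {T : Finset V} {y z : V} (hy : y ∉ T) (hz : z ∉ T) :
    exchV y z (insert y T) = insert z T := by
  ext t
  rw [mem_exchV]
  grind

theorem downUp_energy_le {Λ : Finset V} {α : V → ℝ} {B : ℝ} (hα : ∀ x ∈ Λ, |α x| ≤ B) {n : ℕ}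
    (hn : n < Λ.card) (f : Finset V → ℝ) :
    ∑ S ∈ Λ.powersetCard (n + 1), canWeight α S * f S ^ 2 -
      ∑ S ∈ Λ.powersetCard (n + 1), canWeight α S * (f S * downUp Λ α n f S) ≤
      Real.exp (2 * B) / (2 * (n + 1) * ((Λ.card : ℝ) - n)) *
        ∑ x ∈ Λ, ∑ y ∈ Λ, exchForm Λ (n + 1) (canWeight α) f x y := by
  have hM : (0 : ℝ) < (Λ.card : ℝ) - n := by
    rw [sub_pos]; exact_mod_cast hn
  have h1 : ∑ S ∈ Λ.powersetCard (n + 1), canWeight α S * f S ^ 2 =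
      (∑ T ∈ Λ.powersetCard n, canWeight α T *
        ∑ y ∈ Λ \ T, Real.exp (α y) * f (insert y T) ^ 2) / (n + 1) := by
    rw [← sum_canWeight_succ Λ α n (fun S _ _ => f S ^ 2), eq_div_iff (by positivity),
      Finset.sum_mul]
    refine Finset.sum_congr rfl fun S hS => ?_
    rw [Finset.sum_const, (Finset.mem_powersetCard.1 hS).2]
    simp only [nsmul_eq_mul]
    push_cast
    ring
  have h2 : ∑ S ∈ Λ.powersetCard (n + 1), canWeight α S * ∑ x ∈ S, ∑ z ∈ Λ, gradV x z f S ^ 2 ≤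
      ∑ x ∈ Λ, ∑ y ∈ Λ, exchForm Λ (n + 1) (canWeight α) f x y := by
    have e : ∑ x ∈ Λ, ∑ y ∈ Λ, exchForm Λ (n + 1) (canWeight α) f x y =
        ∑ S ∈ Λ.powersetCard (n + 1), canWeight α S * ∑ x ∈ Λ, ∑ z ∈ Λ, gradV x z f S ^ 2 := by
      simp only [exchForm, Finset.mul_sum]
      rw [Finset.sum_comm]
      conv_rhs => rw [Finset.sum_comm]
      rw [Finset.sum_comm]
      refine Finset.sum_congr rfl fun x _ => Finset.sum_comm
    rw [e]
    refine Finset.sum_le_sum fun S hS => mul_le_mul_of_nonneg_left ?_ (canWeight_pos α S).le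
    exact Finset.sum_le_sum_of_subset_of_nonneg (Finset.mem_powersetCard.1 hS).1
      fun x _ _ => Finset.sum_nonneg fun z _ => sq_nonneg _
  rw [sum_canWeight_succ Λ α n (fun S _ x => ∑ z ∈ Λ, gradV x z f S ^ 2)] at h2
  rw [h1, sum_canWeight_mul_downUp α hn, ← sub_div, ← Finset.sum_sub_distrib]
  refine le_trans ?_ (mul_le_mul_of_nonneg_left h2 (by positivity))
  rw [div_le_iff₀ (by positivity), Finset.mul_sum, Finset.sum_mul]
  refine Finset.sum_le_sum fun T hT => ?_
  have hZ := upMass_pos α hn hT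
  have hT' := Finset.mem_powersetCard.1 hT
  have hZ2 : Real.exp (-B) * ((Λ.card : ℝ) - n) ≤ upMass Λ α T := by
    have : ∑ y ∈ Λ \ T, Real.exp (-B) ≤ upMass Λ α T := by
      refine Finset.sum_le_sum fun y hy => Real.exp_le_exp.2 ?_
      exact (abs_le.1 (hα y (Finset.mem_sdiff.1 hy).1)).1
    rw [Finset.sum_const, Finset.card_sdiff_of_subset hT'.1, hT'.2, nsmul_eq_mul,
      Nat.cast_sub hn.le] at this
    linarith
  rw [← mul_sub]
  have h3 := sum_mul_sum_mul_sub_sq (Λ \ T) (fun y => Real.exp (α y)) (fun y => f (insert y T))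
  have h4 : ∑ y ∈ Λ \ T, ∑ z ∈ Λ \ T, Real.exp (α y) * Real.exp (α z) *
      (f (insert y T) - f (insert z T)) ^ 2 ≤
      Real.exp B * ∑ y ∈ Λ \ T, Real.exp (α y) * ∑ z ∈ Λ, gradV y z f (insert y T) ^ 2 := by
    rw [Finset.mul_sum]
    refine Finset.sum_le_sum fun y hy => ?_
    calc _ ≤ ∑ z ∈ Λ \ T, Real.exp B * (Real.exp (α y) * gradV y z f (insert y T) ^ 2) := ?_
      _ ≤ ∑ z ∈ Λ, Real.exp B * (Real.exp (α y) * gradV y z f (insert y T) ^ 2) := ?_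
      _ = _ := ?_
    · refine Finset.sum_le_sum fun z hz => ?_
      rw [gradV, insert_exchV (Finset.mem_sdiff.1 hy).2 (Finset.mem_sdiff.1 hz).2]
      have hz1 := Real.exp_le_exp.2 (abs_le.1 (hα z (Finset.mem_sdiff.1 hz).1)).2
      have : 0 ≤ Real.exp (α y) * (f (insert y T) - f (insert z T)) ^ 2 := by positivity
      calc _ = Real.exp (α z) * (Real.exp (α y) * (f (insert y T) - f (insert z T)) ^ 2) := by ring
        _ ≤ Real.exp B * (Real.exp (α y) * (f (insert y T) - f (insert z T)) ^ 2) :=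
          mul_le_mul_of_nonneg_right hz1 this
        _ = _ := by ring
    · exact Finset.sum_le_sum_of_subset_of_nonneg Finset.sdiff_subset fun z _ _ => by positivity
    · rw [← Finset.mul_sum, ← Finset.mul_sum]
  rw [h3] at h4
  set A := ∑ y ∈ Λ \ T, Real.exp (α y) * ∑ z ∈ Λ, gradV y z f (insert y T) ^ 2 with hA
  have hA0 : 0 ≤ A := Finset.sum_nonneg fun y _ => mul_nonneg (Real.exp_pos _).le
    (Finset.sum_nonneg fun z _ => sq_nonneg _)
  have h5 : ∑ y ∈ Λ \ T, Real.exp (α y) * f (insert y T) ^ 2 -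
      upMass Λ α T * (upAvg Λ α f T * upAvg Λ α f T) ≤
      Real.exp (2 * B) / (2 * ((Λ.card : ℝ) - n)) * A := by
    have e1 : ∑ y ∈ Λ \ T, Real.exp (α y) * f (insert y T) ^ 2 -
      upMass Λ α T * (upAvg Λ α f T * upAvg Λ α f T) =
      (upMass Λ α T * ∑ y ∈ Λ \ T, Real.exp (α y) * f (insert y T) ^ 2 -
        (∑ y ∈ Λ \ T, Real.exp (α y) * f (insert y T)) ^ 2) / upMass Λ α T := by
      unfold upAvg
      field_simp
    rw [e1, div_le_iff₀ hZ]
    have e2 : Real.exp (2 * B) * Real.exp (-B) = Real.exp B := by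
      rw [← Real.exp_add]; congr 1; ring
    have e3 : Real.exp B / 2 * A ≤
        Real.exp (2 * B) / (2 * ((Λ.card : ℝ) - n)) * A * upMass Λ α T := by
      calc Real.exp B / 2 * A = Real.exp (2 * B) / (2 * ((Λ.card : ℝ) - n)) * A *
            (Real.exp (-B) * ((Λ.card : ℝ) - n)) := by
              rw [← e2]; field_simp
        _ ≤ _ := mul_le_mul_of_nonneg_left hZ2 (by positivity)
    unfold upMass at *
    linarith
  calc _ ≤ canWeight α T * (Real.exp (2 * B) / (2 * ((Λ.card : ℝ) - n)) * A) :=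
        mul_le_mul_of_nonneg_left h5 (canWeight_pos α T).le
    _ = _ := by field_simp

end DownUpWalk

section DownUpContraction

variable {V : Type*} [DecidableEq V]

/-- `f` changes by at most `K` when one of its `n + 1` particles is moved. -/
def MoveBound (Λ : Finset V) (n : ℕ) (K : ℝ) (f : Finset V → ℝ) : Prop :=
  ∀ T ∈ Λ.powersetCard n, ∀ a ∈ Λ \ T, ∀ b ∈ Λ \ T, |f (insert a T) - f (insert b T)| ≤ K

theorem abs_mul_sub_mul_le {A B K s t u : ℝ} (hs : 0 ≤ s) (ht : 0 ≤ t) (hsu : s ≤ u)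
    (htu : t ≤ u) (hA : |A| ≤ K) (hB : |B| ≤ K) (hAB : |A - B| ≤ K) : |s * A - t * B| ≤ u * K := by
  have hK : 0 ≤ K := (abs_nonneg _).trans hA
  rcases le_total t s with h | h
  · calc |s * A - t * B| = |t * (A - B) + (s - t) * A| := by ring_nf
      _ ≤ |t * (A - B)| + |(s - t) * A| := abs_add_le _ _
      _ = t * |A - B| + (s - t) * |A| := by
        rw [abs_mul, abs_mul, abs_of_nonneg ht, abs_of_nonneg (sub_nonneg.2 h)]
      _ ≤ t * K + (s - t) * K := by gcongr
      _ = s * K := by ring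
      _ ≤ u * K := by gcongr
  · calc |s * A - t * B| = |s * (A - B) - (t - s) * B| := by ring_nf
      _ ≤ |s * (A - B)| + |(t - s) * B| := abs_sub _ _
      _ = s * |A - B| + (t - s) * |B| := by
        rw [abs_mul, abs_mul, abs_of_nonneg hs, abs_of_nonneg (sub_nonneg.2 h)]
      _ ≤ s * K + (t - s) * K := by gcongr
      _ = t * K := by ring
      _ ≤ u * K := by gcongr

theorem upAvg_insert_sub_le {Λ : Finset V} (α : V → ℝ) {n : ℕ} {K : ℝ} {f : Finset V → ℝ}
    (hf : MoveBound Λ n K f) {R : Finset V} (hR : R ⊆ Λ) (hRn : R.card + 1 = n) {a b : V}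
    (ha : a ∈ Λ \ R) (hb : b ∈ Λ \ R) (hab : a ≠ b) :
    |upAvg Λ α f (insert a R) - upAvg Λ α f (insert b R)| ≤ K := by
  rw [Finset.mem_sdiff] at ha hb
  set H := Λ \ insert a (insert b R) with hH
  have hHa : Λ \ insert a R = insert b H := by ext; grind
  have hHb : Λ \ insert b R = insert a H := by ext; grind
  have hbH : b ∉ H := by grind
  have haH : a ∉ H := by grind
  set W := ∑ y ∈ H, Real.exp (α y) with hW
  have hW0 : 0 ≤ W := Finset.sum_nonneg fun y _ => (Real.exp_pos _).le
  set F := f (insert b (insert a R)) with hF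
  have hF' : f (insert a (insert b R)) = F := by rw [hF, Finset.insert_comm]
  have pb := Real.exp_pos (α b)
  have pa := Real.exp_pos (α a)
  have mem : ∀ c ∈ Λ, c ∉ R → insert c R ∈ Λ.powersetCard n := by
    intro c hc hcR
    rw [Finset.mem_powersetCard, Finset.card_insert_of_notMem hcR]
    exact ⟨Finset.insert_subset hc hR, hRn⟩
  have expand : ∀ c d : V, c ∉ H → Λ \ insert d R = insert c H →
      f (insert c (insert d R)) = F → upAvg Λ α f (insert d R) =
      F + ∑ y ∈ H, Real.exp (α y) *
        (1 / (Real.exp (α c) + W) * (f (insert y (insert d R)) - F)) := by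
    intro c d hc hd hFc
    have pc := Real.exp_pos (α c)
    have hne : Real.exp (α c) + W ≠ 0 := by positivity
    unfold upAvg upMass
    rw [hd, Finset.sum_insert hc, Finset.sum_insert hc, hFc, ← hW, div_eq_iff hne, add_mul,
      Finset.sum_mul]
    have : ∀ y ∈ H, Real.exp (α y) * (1 / (Real.exp (α c) + W) * (f (insert y (insert d R)) - F)) *
        (Real.exp (α c) + W) = Real.exp (α y) * f (insert y (insert d R)) - Real.exp (α y) * F := by
      intro y _
      field_simp
    rw [Finset.sum_congr rfl this, Finset.sum_sub_distrib, ← Finset.sum_mul, ← hW]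
    ring
  rw [expand b a hbH hHa rfl, expand a b haH hHb hF', add_sub_add_left_eq_sub,
    ← Finset.sum_sub_distrib]
  set s := 1 / (Real.exp (α b) + W) with hs
  set t := 1 / (Real.exp (α a) + W) with ht
  have hs0 : 0 ≤ s := by positivity
  have ht0 : 0 ≤ t := by positivity
  have hsW : W * s ≤ 1 := by
    rw [hs, mul_one_div, div_le_one (by positivity)]; linarith
  have htW : W * t ≤ 1 := by
    rw [ht, mul_one_div, div_le_one (by positivity)]; linarith
  have hK : 0 ≤ K := (abs_nonneg _).trans
    (hf _ (mem a ha.1 ha.2) b (by grind) b (by grind))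
  calc _ ≤ ∑ y ∈ H, |Real.exp (α y) * (s * (f (insert y (insert a R)) - F)) -
        Real.exp (α y) * (t * (f (insert y (insert b R)) - F))| := Finset.abs_sum_le_sum_abs _ _
    _ ≤ ∑ y ∈ H, Real.exp (α y) * (max s t * K) := ?_
    _ = W * max s t * K := by rw [← Finset.sum_mul, mul_assoc]
    _ ≤ 1 * K := ?_
    _ = K := one_mul K
  · refine Finset.sum_le_sum fun y hy => ?_
    have hyH : y ∈ Λ ∧ y ≠ a ∧ y ≠ b ∧ y ∉ R := by grind
    rw [← mul_sub, abs_mul, abs_of_pos (Real.exp_pos _)]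
    refine mul_le_mul_of_nonneg_left ?_ (Real.exp_pos _).le
    refine abs_mul_sub_mul_le hs0 ht0 (le_max_left _ _) (le_max_right _ _) ?_ ?_ ?_
    · exact hf _ (mem a ha.1 ha.2) y (by grind) b (by grind)
    · rw [← hF']
      exact hf _ (mem b hb.1 hb.2) y (by grind) a (by grind)
    · rw [sub_sub_sub_cancel_right, Finset.insert_comm y a, Finset.insert_comm y b]
      exact hf _ (mem y hyH.1 hyH.2.2.2) a (by grind) b (by grind)
  · refine mul_le_mul_of_nonneg_right ?_ hK
    rcases max_cases s t with h | h <;> rw [h.1] <;> assumption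

theorem MoveBound.downUp {Λ : Finset V} (α : V → ℝ) {n : ℕ} {K : ℝ} {f : Finset V → ℝ}
    (hf : MoveBound Λ n K f) : MoveBound Λ n (n / (n + 1) * K) (downUp Λ α n f) := by
  intro T hT a ha b hb
  have hT' := Finset.mem_powersetCard.1 hT
  have hK : 0 ≤ K := (abs_nonneg _).trans (hf T hT a ha a ha)
  by_cases hab : a = b
  · subst hab
    rw [sub_self, abs_zero]
    positivity
  rw [Finset.mem_sdiff] at ha hb
  have expand : ∀ c ∉ T, ∑ x ∈ insert c T, upAvg Λ α f ((insert c T).erase x) =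
      upAvg Λ α f T + ∑ x ∈ T, upAvg Λ α f (insert c (T.erase x)) := by
    intro c hc
    rw [Finset.sum_insert hc, Finset.erase_insert hc]
    congr 1
    refine Finset.sum_congr rfl fun x hx => ?_
    rw [Finset.erase_insert_of_ne (by rintro rfl; exact hc hx)]
  unfold _root_.downUp
  rw [expand a ha.2, expand b hb.2, ← sub_div, add_sub_add_left_eq_sub,
    ← Finset.sum_sub_distrib, abs_div, abs_of_pos (by positivity : (0 : ℝ) < n + 1),
    div_mul_eq_mul_div]
  refine div_le_div_of_nonneg_right ?_ (by positivity)
  calc _ ≤ ∑ x ∈ T, |upAvg Λ α f (insert a (T.erase x)) - upAvg Λ α f (insert b (T.erase x))| :=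
        Finset.abs_sum_le_sum_abs _ _
    _ ≤ ∑ x ∈ T, K := ?_
    _ = _ := by rw [Finset.sum_const, hT'.2, nsmul_eq_mul]
  refine Finset.sum_le_sum fun x hx => ?_
  refine upAvg_insert_sub_le α hf ((Finset.erase_subset _ _).trans hT'.1) ?_ (by grind)
    (by grind) hab
  rw [Finset.card_erase_add_one hx, hT'.2]

theorem MoveBound.abs_sub_le {Λ : Finset V} {n : ℕ} {K : ℝ} {f : Finset V → ℝ}
    (hf : MoveBound Λ n K f) {S : Finset V} (hS : S ∈ Λ.powersetCard (n + 1)) {S' : Finset V}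
    (hS' : S' ∈ Λ.powersetCard (n + 1)) : |f S - f S'| ≤ (S \ S').card * K := by
  induction hk : (S \ S').card generalizing S with
  | zero =>
    rw [Finset.card_eq_zero, Finset.sdiff_eq_empty_iff_subset] at hk
    rw [Finset.mem_powersetCard] at hS hS'
    rw [Finset.eq_of_subset_of_card_le hk (by omega)]
    simp
  | succ k ih =>
    have hS1 := Finset.mem_powersetCard.1 hS
    have hS1' := Finset.mem_powersetCard.1 hS'
    obtain ⟨a, ha⟩ : (S \ S').Nonempty := by rw [← Finset.card_pos]; omega
    have hk' : (S' \ S).card = k + 1 := by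
      rw [← hk, Finset.card_sdiff_comm (by omega)]
    obtain ⟨b, hb⟩ : (S' \ S).Nonempty := by rw [← Finset.card_pos]; omega
    rw [Finset.mem_sdiff] at ha hb
    have hT : S.erase a ∈ Λ.powersetCard n := by
      rw [Finset.mem_powersetCard, Finset.card_erase_of_mem ha.1, hS1.2]
      exact ⟨(Finset.erase_subset _ _).trans hS1.1, rfl⟩
    have hU : insert b (S.erase a) ∈ Λ.powersetCard (n + 1) := by
      rw [Finset.mem_powersetCard, Finset.card_insert_of_notMem (by grind),
        Finset.card_erase_of_mem ha.1, hS1.2]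
      exact ⟨Finset.insert_subset (hS1'.1 hb.1) ((Finset.erase_subset _ _).trans hS1.1), rfl⟩
    have hc : (insert b (S.erase a) \ S').card = k := by
      have : insert b (S.erase a) \ S' = (S \ S').erase a := by ext; grind
      rw [this, Finset.card_erase_of_mem (by grind), hk]
      rfl
    have h1 := ih hU hc
    have h2 := hf _ hT a (by grind) b (by grind)
    rw [Finset.insert_erase ha.1] at h2
    have h3 := _root_.abs_sub_le (f S) (f (insert b (S.erase a))) (f S')
    push_cast
    linarith

theorem le_mul_of_logConvex_of_le_pow {b : ℕ → ℝ} {C r : ℝ} (hb : ∀ k, 0 ≤ b k) (hr : 0 ≤ r)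
    (hlog : ∀ k, b (k + 1) ^ 2 ≤ b k * b (k + 2)) (hC : ∀ k, b k ≤ C * r ^ k) :
    b 1 ≤ r * b 0 := by
  by_contra! hlt
  have h0 : b 0 ≠ 0 := by
    intro h
    have := hlog 0
    rw [h, zero_mul] at this
    have h1 : b 1 = 0 := by simpa using le_antisymm this (sq_nonneg _)
    rw [h, h1] at hlt
    simp at hlt
  have h0' : 0 < b 0 := lt_of_le_of_ne (hb 0) h0.symm
  have h1' : 0 < b 1 := lt_of_le_of_lt (mul_nonneg hr h0'.le) hlt
  set t := b 1 / b 0 with ht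
  have ht0 : 0 < t := by positivity
  have hrt : r < t := by rwa [ht, lt_div_iff₀ h0']
  have hstep : ∀ k, 0 < b k ∧ t * b k ≤ b (k + 1) := by
    intro k
    induction k with
    | zero => exact ⟨h0', by rw [ht]; field_simp; rfl⟩
    | succ k ih =>
      have hpos : 0 < b (k + 1) := lt_of_lt_of_le (mul_pos ht0 ih.1) ih.2
      refine ⟨hpos, ?_⟩
      have h := hlog k
      have h3 : t * b k * b (k + 1) ≤ b (k + 1) ^ 2 := by
        rw [sq]; exact mul_le_mul_of_nonneg_right ih.2 hpos.le
      have h4 : b k * (t * b (k + 1)) ≤ b k * b (k + 2) := by linarith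
      exact le_of_mul_le_mul_left h4 ih.1
  have hpow : ∀ k, t ^ k * b 0 ≤ b k := by
    intro k
    induction k with
    | zero => simp
    | succ k ih =>
      calc t ^ (k + 1) * b 0 = t * (t ^ k * b 0) := by ring
        _ ≤ t * b k := mul_le_mul_of_nonneg_left ih ht0.le
        _ ≤ _ := (hstep k).2
  rcases hr.eq_or_lt with hr0 | hr0
  · have := hC 1
    rw [← hr0] at this
    simp at this
    linarith
  · obtain ⟨k, hk⟩ := pow_unbounded_of_one_lt (C / b 0) ((one_lt_div hr0).2 hrt)
    have := (hpow k).trans (hC k)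
    rw [div_lt_iff₀ h0', div_pow, div_mul_eq_mul_div, lt_div_iff₀ (by positivity)] at hk
    linarith

omit [DecidableEq V] in
theorem sum_mul_sq_le (s : Finset (Finset V)) {w : Finset V → ℝ} (hw : ∀ S, 0 ≤ w S)
    (f g : Finset V → ℝ) : (∑ S ∈ s, w S * (f S * g S)) ^ 2 ≤
      (∑ S ∈ s, w S * f S ^ 2) * ∑ S ∈ s, w S * g S ^ 2 :=
  Finset.sum_sq_le_sum_mul_sum_of_sq_le_mul s (fun S _ => mul_nonneg (hw S) (sq_nonneg _))
    (fun S _ => mul_nonneg (hw S) (sq_nonneg _)) fun S _ =>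
      (by ring : (w S * (f S * g S)) ^ 2 = w S * f S ^ 2 * (w S * g S ^ 2)).le

theorem downUp_spectral_gap {Λ : Finset V} (α : V → ℝ) {n : ℕ} (hn : n < Λ.card)
    {f : Finset V → ℝ} (hf : ∑ S ∈ Λ.powersetCard (n + 1), canWeight α S * f S = 0) :
    ∑ S ∈ Λ.powersetCard (n + 1), canWeight α S * f S ^ 2 ≤ (n + 1) *
      (∑ S ∈ Λ.powersetCard (n + 1), canWeight α S * f S ^ 2 -
        ∑ S ∈ Λ.powersetCard (n + 1), canWeight α S * (f S * downUp Λ α n f S)) := by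
  set X := Λ.powersetCard (n + 1) with hX
  have hw0 : ∀ S, 0 ≤ canWeight α S := fun S => (canWeight_pos α S).le
  set q : ℝ := n / (n + 1) with hq
  have hq0 : 0 ≤ q := by positivity
  set g : ℕ → Finset V → ℝ := fun k => (downUp Λ α n)^[k] f with hg
  have gsucc : ∀ k, g (k + 1) = downUp Λ α n (g k) := fun k =>
    Function.iterate_succ_apply' _ _ _
  have gmean : ∀ k, ∑ S ∈ X, canWeight α S * g k S = 0 := by
    intro k
    induction k with
    | zero => exact hf
    | succ k ih => rw [gsucc, sum_canWeight_downUp α hn, ih]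
  obtain ⟨K, hK⟩ : ∃ K, MoveBound Λ n K f := by
    refine ⟨∑ S ∈ X, |f S| + ∑ S ∈ X, |f S|, fun T hT a ha b hb => ?_⟩
    have mem : ∀ c ∈ Λ \ T, |f (insert c T)| ≤ ∑ S ∈ X, |f S| := by
      intro c hc
      refine Finset.single_le_sum (f := fun S => |f S|) (fun S _ => abs_nonneg _) ?_
      rw [Finset.mem_powersetCard] at hT
      rw [Finset.mem_sdiff] at hc
      rw [hX, Finset.mem_powersetCard, Finset.card_insert_of_notMem hc.2, hT.2]
      exact ⟨Finset.insert_subset hc.1 hT.1, rfl⟩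
    exact (abs_sub _ _).trans (add_le_add (mem a ha) (mem b hb))
  have gmove : ∀ k, MoveBound Λ n (q ^ k * K) (g k) := by
    intro k
    induction k with
    | zero => rw [pow_zero, one_mul]; exact hK
    | succ k ih =>
      rw [gsucc, pow_succ', mul_assoc]
      exact ih.downUp α
  set b : ℕ → ℝ := fun k => ∑ S ∈ X, canWeight α S * g k S ^ 2 with hb
  have hb0 : ∀ k, 0 ≤ b k := fun k =>
    Finset.sum_nonneg fun S _ => mul_nonneg (hw0 S) (sq_nonneg _)
  have hlog : ∀ k, b (k + 1) ^ 2 ≤ b k * b (k + 2) := by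
    intro k
    have e : b (k + 1) = ∑ S ∈ X, canWeight α S * (g k S * g (k + 2) S) := by
      have h := sum_canWeight_downUp_symm α hn (g (k + 1)) (g k)
      rw [← gsucc, ← gsucc] at h
      rw [hX, h]
      simp only [hb, hX, sq]
    rw [e]
    exact sum_mul_sq_le X hw0 _ _
  have hgb : ∀ k, ∀ S ∈ X, g k S ^ 2 ≤ ((n + 1) * K) ^ 2 * (q ^ 2) ^ k := by
    intro k S hS
    have hK0 : 0 ≤ q ^ k * K := by
      have hXc := Finset.mem_powersetCard.1 hS
      obtain ⟨a, ha⟩ : S.Nonempty := by rw [← Finset.card_pos]; omega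
      refine (abs_nonneg _).trans (gmove k (S.erase a) ?_ a (by grind) a (by grind))
      rw [Finset.mem_powersetCard, Finset.card_erase_of_mem ha, hXc.2]
      exact ⟨(Finset.erase_subset _ _).trans hXc.1, rfl⟩
    have hd : ∀ S' ∈ X, |g k S - g k S'| ≤ (n + 1) * (q ^ k * K) := by
      intro S' hS'
      refine ((gmove k).abs_sub_le hS hS').trans (mul_le_mul_of_nonneg_right ?_ hK0)
      have : (S \ S').card ≤ n + 1 := by
        rw [← (Finset.mem_powersetCard.1 hS).2]
        exact Finset.card_le_card Finset.sdiff_subset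
      exact_mod_cast this
    have hZ : 0 < ∑ S' ∈ X, canWeight α S' :=
      Finset.sum_pos (fun S' _ => canWeight_pos α S') ⟨S, hS⟩
    have h1 : |g k S| * ∑ S' ∈ X, canWeight α S' ≤
        (n + 1) * (q ^ k * K) * ∑ S' ∈ X, canWeight α S' := by
      calc |g k S| * ∑ S' ∈ X, canWeight α S' = |g k S * ∑ S' ∈ X, canWeight α S'| := by
            rw [abs_mul, abs_of_pos hZ]
        _ = |∑ S' ∈ X, canWeight α S' * (g k S - g k S')| := by
            simp only [mul_sub, Finset.sum_sub_distrib]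
            rw [gmean k, sub_zero, ← Finset.sum_mul, mul_comm]
        _ ≤ ∑ S' ∈ X, |canWeight α S' * (g k S - g k S')| := Finset.abs_sum_le_sum_abs _ _
        _ ≤ ∑ S' ∈ X, canWeight α S' * ((n + 1) * (q ^ k * K)) := by
            refine Finset.sum_le_sum fun S' hS' => ?_
            rw [abs_mul, abs_of_pos (canWeight_pos α S')]
            exact mul_le_mul_of_nonneg_left (hd S' hS') (hw0 S')
        _ = _ := by rw [← Finset.sum_mul, mul_comm]
    have h2 := le_of_mul_le_mul_right h1 hZ
    calc g k S ^ 2 = |g k S| ^ 2 := (sq_abs _).symm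
      _ ≤ ((n + 1) * (q ^ k * K)) ^ 2 := pow_le_pow_left₀ (abs_nonneg _) h2 2
      _ = _ := by ring
  have hC : ∀ k, b k ≤ (∑ S ∈ X, canWeight α S) * ((n + 1) * K) ^ 2 * (q ^ 2) ^ k := by
    intro k
    rw [mul_assoc, Finset.sum_mul]
    exact Finset.sum_le_sum fun S hS => mul_le_mul_of_nonneg_left (hgb k S hS) (hw0 S)
  have hb1 := le_mul_of_logConvex_of_le_pow hb0 (by positivity) hlog hC
  have hcs : (∑ S ∈ X, canWeight α S * (f S * downUp Λ α n f S)) ^ 2 ≤ (q * b 0) ^ 2 := by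
    calc _ ≤ b 0 * b 1 := sum_mul_sq_le X hw0 _ _
      _ ≤ b 0 * (q ^ 2 * b 0) := mul_le_mul_of_nonneg_left hb1 (hb0 0)
      _ = _ := by ring
  have hin := le_of_sq_le_sq hcs (mul_nonneg hq0 (hb0 0))
  change b 0 ≤ (n + 1) * (b 0 - _)
  have hq1 : (n + 1) * (q * b 0) = n * b 0 := by
    rw [hq]; field_simp
  have := mul_le_mul_of_nonneg_left hin (by positivity : (0 : ℝ) ≤ n + 1)
  linarith

end DownUpContraction

section MeanField

variable {V : Type*} [DecidableEq V]

theorem sum_powersetCard_sdiff (Λ : Finset V) {N N' : ℕ} (hN : N + N' = Λ.card)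
    (G : Finset V → ℝ) :
    ∑ S ∈ Λ.powersetCard N, G (Λ \ S) = ∑ S ∈ Λ.powersetCard N', G S := by
  have mem : ∀ a b : ℕ, a + b = Λ.card → ∀ S ∈ Λ.powersetCard a, Λ \ S ∈ Λ.powersetCard b := by
    intro a b hab S hS
    rw [Finset.mem_powersetCard] at hS ⊢
    refine ⟨Finset.sdiff_subset, ?_⟩
    rw [Finset.card_sdiff_of_subset hS.1]
    omega
  refine Finset.sum_nbij' (Λ \ ·) (Λ \ ·) (mem N N' hN) (mem N' N (by omega)) ?_ ?_ fun _ _ => rfl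
  · intro S hS
    exact Finset.sdiff_sdiff_eq_self (Finset.mem_powersetCard.1 hS).1
  · intro S hS
    exact Finset.sdiff_sdiff_eq_self (Finset.mem_powersetCard.1 hS).1

theorem canWeight_sdiff (α : V → ℝ) {Λ S : Finset V} (hS : S ⊆ Λ) :
    canWeight α (Λ \ S) = canWeight α Λ * canWeight (-α) S := by
  unfold canWeight
  rw [← Real.exp_add, ← Finset.sum_sdiff hS]
  simp

theorem exchV_sdiff {Λ : Finset V} {x y : V} (hx : x ∈ Λ) (hy : y ∈ Λ) (S : Finset V) :
    exchV x y (Λ \ S) = Λ \ exchV x y S := by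
  ext t
  simp only [mem_exchV, Finset.mem_sdiff]
  grind

theorem sum_canWeight_sdiff (α : V → ℝ) {Λ : Finset V} {N N' : ℕ} (hN : N + N' = Λ.card)
    (G : Finset V → ℝ) :
    ∑ S ∈ Λ.powersetCard N, canWeight α S * G S =
      canWeight α Λ * ∑ S ∈ Λ.powersetCard N', canWeight (-α) S * G (Λ \ S) := by
  rw [← sum_powersetCard_sdiff Λ (N := N') (N' := N) (by omega), Finset.mul_sum]
  refine Finset.sum_congr rfl fun S hS => ?_
  rw [canWeight_sdiff α (Finset.mem_powersetCard.1 hS).1, mul_assoc]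

theorem exchForm_canWeight_sdiff (α : V → ℝ) {Λ : Finset V} {N N' : ℕ} (hN : N + N' = Λ.card)
    (f : Finset V → ℝ) {x y : V} (hx : x ∈ Λ) (hy : y ∈ Λ) :
    exchForm Λ N (canWeight α) f x y =
      canWeight α Λ * exchForm Λ N' (canWeight (-α)) (fun S => f (Λ \ S)) x y := by
  unfold exchForm
  rw [sum_canWeight_sdiff α hN]
  simp only [gradV, exchV_sdiff hx hy]

theorem meanField_poincare_of_two_mul_le {Λ : Finset V} {α : V → ℝ} {B : ℝ}
    (hα : ∀ x ∈ Λ, |α x| ≤ B) {N : ℕ} (hN : N ≤ Λ.card) (hN2 : 2 * N ≤ Λ.card + 2)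
    {f : Finset V → ℝ} (hf : ∑ S ∈ Λ.powersetCard N, canWeight α S * f S = 0) :
    Λ.card * ∑ S ∈ Λ.powersetCard N, canWeight α S * f S ^ 2 ≤
      Real.exp (2 * B) * ∑ x ∈ Λ, ∑ y ∈ Λ, exchForm Λ N (canWeight α) f x y := by
  set E := ∑ x ∈ Λ, ∑ y ∈ Λ, exchForm Λ N (canWeight α) f x y with hE
  have hE0 : 0 ≤ E := Finset.sum_nonneg fun x _ => Finset.sum_nonneg fun y _ =>
    exchForm_nonneg _ _ _ _ _ _ fun S _ => (canWeight_pos α S).le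
  rcases N with _ | n
  · rw [Finset.powersetCard_zero, Finset.sum_singleton] at hf
    have h0 : f ∅ = 0 := (mul_eq_zero.1 hf).resolve_left (canWeight_pos α ∅).ne'
    rw [Finset.powersetCard_zero, Finset.sum_singleton, h0]
    have := mul_nonneg (Real.exp_pos (2 * B)).le hE0
    simpa using this
  · have hn : n < Λ.card := hN
    have hM : (0 : ℝ) < (Λ.card : ℝ) - n := by
      rw [sub_pos]; exact_mod_cast hn
    have h2 : (Λ.card : ℝ) ≤ 2 * (Λ.card - n) := by
      have : ((2 * n : ℕ) : ℝ) ≤ (Λ.card : ℕ) := by exact_mod_cast (by omega)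
      push_cast at this
      linarith
    have h := (downUp_spectral_gap α hn hf).trans
      (mul_le_mul_of_nonneg_left (downUp_energy_le hα hn f) (by positivity))
    have e : ((n : ℝ) + 1) * (Real.exp (2 * B) / (2 * (n + 1) * ((Λ.card : ℝ) - n)) * E) =
        Real.exp (2 * B) * E / (2 * (Λ.card - n)) := by
      field_simp
    rw [← hE, e, le_div_iff₀ (by positivity), mul_comm] at h
    refine le_trans (mul_le_mul_of_nonneg_right h2 ?_) h
    exact Finset.sum_nonneg fun S _ => mul_nonneg (canWeight_pos α S).le (sq_nonneg _)

/-- The Poincaré inequality for the mean-field exchange dynamics. -/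
theorem meanField_poincare {Λ : Finset V} {α : V → ℝ} {B : ℝ}
    (hα : ∀ x ∈ Λ, |α x| ≤ B) {N : ℕ} (hN : N ≤ Λ.card)
    {f : Finset V → ℝ} (hf : ∑ S ∈ Λ.powersetCard N, canWeight α S * f S = 0) :
    Λ.card * ∑ S ∈ Λ.powersetCard N, canWeight α S * f S ^ 2 ≤
      Real.exp (2 * B) * ∑ x ∈ Λ, ∑ y ∈ Λ, exchForm Λ N (canWeight α) f x y := by
  by_cases hN2 : 2 * N ≤ Λ.card + 2
  · exact meanField_poincare_of_two_mul_le hα hN hN2 hf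
  have hNN : N + (Λ.card - N) = Λ.card := by omega
  have hw := canWeight_pos α Λ
  rw [sum_canWeight_sdiff α hNN, mul_eq_zero] at hf
  have h := meanField_poincare_of_two_mul_le (α := -α) (B := B) (by simpa using hα)
    (N := Λ.card - N) (by omega) (by omega) (hf.resolve_left hw.ne')
  have e : ∑ x ∈ Λ, ∑ y ∈ Λ, exchForm Λ N (canWeight α) f x y = canWeight α Λ *
      ∑ x ∈ Λ, ∑ y ∈ Λ, exchForm Λ (Λ.card - N) (canWeight (-α)) (fun S => f (Λ \ S)) x y := by
    rw [Finset.mul_sum]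
    refine Finset.sum_congr rfl fun x hx => ?_
    rw [Finset.mul_sum]
    exact Finset.sum_congr rfl fun y hy => exchForm_canWeight_sdiff α hNN f hx hy
  rw [sum_canWeight_sdiff α hNN, e, mul_left_comm, mul_left_comm (Real.exp _)]
  exact mul_le_mul_of_nonneg_left h hw.le

end MeanField

section ChainEstimates

/-- `j < k` are consecutive elements of `F`. -/
def IsGap (F : Finset ℕ) (j k : ℕ) : Prop :=
  j ∈ F ∧ k ∈ F ∧ j < k ∧ Disjoint F (Finset.Ioo j k)

open Classical in
theorem chain_le_sum_gap {D : ℕ → ℕ → ℝ} {F : Finset ℕ} {n : ℕ} (hn : n ∈ F)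
    (hD : ∀ i ∈ F, ∀ j ∈ F, 0 ≤ D i j)
    (htri : ∀ i ∈ F, ∀ j ∈ F, i < j → j < n → ∀ r : ℝ, 0 < r →
      D i n ≤ (r + 1) * (4 * D i j + D j n / r)) (g : ℕ) :
    ∀ i ∈ F, i + g + 1 = n → D i n ≤ 4 * ((n : ℝ) - i) *
      ∑ j ∈ Finset.Ico i n, ∑ k ∈ Finset.Ioc j n, if IsGap F j k then D j k else 0 := by
  induction g using Nat.strong_induction_on with
  | _ g ih =>
  intro i hi hig
  set T : ℕ → ℝ := fun j => ∑ k ∈ Finset.Ioc j n, if IsGap F j k then D j k else 0 with hT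
  have hterm : ∀ j k, 0 ≤ if IsGap F j k then D j k else 0 := by
    intro j k
    split_ifs with h
    · exact hD j h.1 k h.2.1
    · exact le_rfl
  have hT0 : ∀ j, 0 ≤ T j := fun j => Finset.sum_nonneg fun k _ => hterm j k
  have hex : ∃ j, j ∈ F ∧ i < j := ⟨n, hn, by omega⟩
  set j := Nat.find hex with hj
  obtain ⟨hjF, hij⟩ := Nat.find_spec hex
  have hjn : j ≤ n := Nat.find_min' hex ⟨hn, by omega⟩
  have hgap : IsGap F i j := by
    refine ⟨hi, hjF, hij, ?_⟩
    rw [Finset.disjoint_left]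
    intro m hm hm'
    rw [Finset.mem_Ioo] at hm'
    exact Nat.find_min hex hm'.2 ⟨hm, hm'.1⟩
  have hTi : D i j ≤ T i := by
    have := Finset.single_le_sum (f := fun k => if IsGap F i k then D i k else 0)
      (fun k _ => hterm i k) (Finset.mem_Ioc.2 ⟨hij, hjn⟩ : j ∈ Finset.Ioc i n)
    simpa [hgap] using this
  have hDij := hD i hi j hjF
  have hin : (i : ℝ) + 1 ≤ n := by exact_mod_cast (by omega : i + 1 ≤ n)
  have hsplit : T i + ∑ m ∈ Finset.Ico j n, T m ≤ ∑ m ∈ Finset.Ico i n, T m := by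
    rw [← Finset.sum_Ico_consecutive T hij.le hjn]
    gcongr
    exact Finset.single_le_sum (fun m _ => hT0 m) (Finset.mem_Ico.2 ⟨le_rfl, hij⟩)
  have hS0 : 0 ≤ ∑ m ∈ Finset.Ico j n, T m := Finset.sum_nonneg fun m _ => hT0 m
  rcases hjn.eq_or_lt with hjn' | hjn'
  · rw [hjn'] at hTi hsplit hDij hS0
    have h1 : D i n ≤ ∑ m ∈ Finset.Ico i n, T m := by linarith
    have h2 : 0 ≤ ∑ m ∈ Finset.Ico i n, T m := hDij.trans h1
    nlinarith
  · have hji : (i : ℝ) + 1 ≤ j := by exact_mod_cast hij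
    have hjn2 : (0 : ℝ) < n - j := by
      rw [sub_pos]; exact_mod_cast hjn'
    have h1 := htri i hi j hjF hij hjn' _ hjn2
    have h2 := ih (n - j - 1) (by omega) j hjF (by omega)
    have h3 : D j n / ((n : ℝ) - j) ≤ 4 * ∑ m ∈ Finset.Ico j n, T m := by
      rw [div_le_iff₀ hjn2]
      linarith
    calc D i n ≤ ((n : ℝ) - j + 1) * (4 * D i j + 4 * ∑ m ∈ Finset.Ico j n, T m) := by
          refine h1.trans ?_
          gcongr
      _ ≤ ((n : ℝ) - i) * (4 * D i j + 4 * ∑ m ∈ Finset.Ico j n, T m) := by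
          gcongr
          linarith
      _ ≤ ((n : ℝ) - i) * (4 * ∑ m ∈ Finset.Ico i n, T m) := by
          gcongr
          · linarith
          · linarith
      _ = _ := by ring

theorem dyadic_chain_le {D : ℕ → ℕ → ℝ} {n : ℕ} {K : ℝ} (hK : 1 ≤ K)
    (hD : ∀ i j, i ≤ n → j ≤ n → 0 ≤ D i j)
    (htri : ∀ i j k, i < j → j < k → k ≤ n → D i k ≤ K * (D i j + D j k)) (m : ℕ) :
    ∀ i g, 1 ≤ g → g ≤ 2 ^ m → i + g ≤ n →
      D i (i + g) ≤ K ^ m * ∑ e ∈ Finset.Ico i (i + g), D e (e + 1) := by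
  induction m with
  | zero =>
    intro i g h1 h2 _
    have : g = 1 := by rw [pow_zero] at h2; omega
    subst this
    simp
  | succ m ih =>
    intro i g h1 h2 h3
    by_cases hg : g ≤ 2 ^ m
    · refine (ih i g h1 hg h3).trans ?_
      refine mul_le_mul_of_nonneg_right (pow_le_pow_right₀ hK (Nat.le_succ m)) ?_
      refine Finset.sum_nonneg fun e he => hD _ _ ?_ ?_ <;> rw [Finset.mem_Ico] at he <;> omega
    · rw [not_le] at hg
      have hpos : 0 < 2 ^ m := by positivity
      obtain ⟨g', rfl⟩ : ∃ g', g = 2 ^ m + g' := ⟨g - 2 ^ m, by omega⟩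
      have e1 := ih i (2 ^ m) hpos le_rfl (by omega)
      have e2 := ih (i + 2 ^ m) g' (by omega) (by rw [pow_succ] at h2; omega) (by omega)
      have e3 := htri i (i + 2 ^ m) (i + 2 ^ m + g') (by omega) (by omega) (by omega)
      rw [← add_assoc, ← Finset.sum_Ico_consecutive _ (Nat.le_add_right i (2 ^ m))
        (Nat.le_add_right (i + 2 ^ m) g')]
      refine e3.trans ?_
      rw [pow_succ', mul_assoc]
      refine mul_le_mul_of_nonneg_left ?_ (by linarith)
      rw [mul_add]
      exact add_le_add e1 e2

theorem exists_pow_mul_chain_le {θ K : ℝ} (hθ0 : 0 < θ) (hθ1 : θ < 1) (hK : 1 ≤ K) :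
    ∃ C ρ : ℝ, 0 ≤ C ∧ 0 ≤ ρ ∧ ρ < 1 ∧ ∀ (n : ℕ) (D : ℕ → ℕ → ℝ),
      (∀ i j, i ≤ n → j ≤ n → 0 ≤ D i j) →
      (∀ i j k, i < j → j < k → k ≤ n → D i k ≤ K * (D i j + D j k)) →
      ∀ j k, j < k → k ≤ n → θ ^ (k - j - 1) * D j k ≤
        C * (ρ ^ (k - j) * ∑ e ∈ Finset.Ico j k, D e (e + 1)) := by
  set ρ := √θ with hρ
  have hρ0 : 0 < ρ := Real.sqrt_pos.2 hθ0
  have hρ1 : ρ < 1 := by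
    rw [hρ, Real.sqrt_lt' one_pos]; simpa using hθ1
  have hρ2 : ρ ^ 2 = θ := Real.sq_sqrt hθ0.le
  obtain ⟨s, hs⟩ := pow_unbounded_of_one_lt K one_lt_two
  obtain ⟨M, hM⟩ := (tendsto_pow_const_mul_const_pow_of_abs_lt_one s
    (by rwa [abs_of_pos hρ0] : |ρ| < 1)).bddAbove_range
  have hM' : ∀ g : ℕ, (g : ℝ) ^ s * ρ ^ g ≤ M := fun g => hM ⟨g, rfl⟩
  have hM0 : 0 ≤ M := le_trans (by positivity) (hM' 1)
  refine ⟨2 ^ s * M / θ, ρ, by positivity, hρ0.le, hρ1, ?_⟩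
  intro n D hD htri j k hjk hkn
  obtain ⟨g, rfl⟩ : ∃ g, k = j + (g + 1) := ⟨k - j - 1, by omega⟩
  have h := dyadic_chain_le hK hD htri (Nat.clog 2 (g + 1)) j (g + 1) (by omega)
    (Nat.le_pow_clog one_lt_two _) hkn
  have hS : 0 ≤ ∑ e ∈ Finset.Ico j (j + (g + 1)), D e (e + 1) :=
    Finset.sum_nonneg fun e he => by
      rw [Finset.mem_Ico] at he; exact hD _ _ (by omega) (by omega)
  have hclog : (2 : ℝ) ^ Nat.clog 2 (g + 1) ≤ 2 * ((g + 1 : ℕ) : ℝ) := by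
    rcases Nat.eq_zero_or_pos g with rfl | hg
    · simp
    · have h1 := Nat.pow_pred_clog_lt_self one_lt_two (by omega : 1 < g + 1)
      have h2 : 0 < Nat.clog 2 (g + 1) := Nat.clog_pos one_lt_two (by omega)
      obtain ⟨c, hc⟩ : ∃ c, Nat.clog 2 (g + 1) = c + 1 := ⟨Nat.clog 2 (g + 1) - 1, by omega⟩
      rw [hc] at h1 ⊢
      have h3 : (2 : ℝ) ^ c ≤ ((g + 1 : ℕ) : ℝ) := by exact_mod_cast h1.le
      rw [pow_succ']
      linarith
  have hKc : K ^ Nat.clog 2 (g + 1) ≤ 2 ^ s * ((g + 1 : ℕ) : ℝ) ^ s := by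
    calc K ^ Nat.clog 2 (g + 1) ≤ (2 ^ s) ^ Nat.clog 2 (g + 1) :=
          pow_le_pow_left₀ (by linarith) hs.le _
      _ = (2 ^ Nat.clog 2 (g + 1)) ^ s := by rw [← pow_mul, ← pow_mul, mul_comm]
      _ ≤ (2 * ((g + 1 : ℕ) : ℝ)) ^ s := pow_le_pow_left₀ (by positivity) hclog s
      _ = _ := mul_pow _ _ _
  have e1 : j + (g + 1) - j = g + 1 := by omega
  rw [e1, Nat.add_sub_cancel]
  calc θ ^ g * D j (j + (g + 1)) ≤
        θ ^ g * ((2 ^ s * ((g + 1 : ℕ) : ℝ) ^ s) *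
          ∑ e ∈ Finset.Ico j (j + (g + 1)), D e (e + 1)) := by
        refine mul_le_mul_of_nonneg_left (h.trans ?_) (by positivity)
        exact mul_le_mul_of_nonneg_right hKc hS
    _ = 2 ^ s / θ * (ρ ^ (g + 1) * ∑ e ∈ Finset.Ico j (j + (g + 1)), D e (e + 1)) *
          (((g + 1 : ℕ) : ℝ) ^ s * ρ ^ (g + 1)) := by
        rw [← hρ2]
        field_simp
        ring
    _ ≤ 2 ^ s / θ * (ρ ^ (g + 1) * ∑ e ∈ Finset.Ico j (j + (g + 1)), D e (e + 1)) * M :=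
        mul_le_mul_of_nonneg_left (hM' (g + 1)) (by positivity)
    _ = _ := by ring

theorem sum_pow_mul_sum_Ico_le {ρ : ℝ} (hρ0 : 0 ≤ ρ) (hρ1 : ρ < 1) {n : ℕ} {d : ℕ → ℝ}
    (hd : ∀ e < n, 0 ≤ d e) :
    ∑ j ∈ Finset.range n, ∑ k ∈ Finset.Ioc j n, ρ ^ (k - j) * ∑ e ∈ Finset.Ico j k, d e ≤
      (1 - ρ)⁻¹ ^ 2 * ∑ e ∈ Finset.range n, d e := by
  have hgeo : ∀ m : ℕ, ∑ i ∈ Finset.range m, ρ ^ i ≤ (1 - ρ)⁻¹ := fun m => by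
    rw [← tsum_geometric_of_lt_one hρ0 hρ1]
    exact (summable_geometric_of_lt_one hρ0 hρ1).sum_le_tsum _ fun i _ => pow_nonneg hρ0 i
  have hinv : 0 ≤ (1 - ρ)⁻¹ := inv_nonneg.2 (by linarith)
  have hswap : ∑ j ∈ Finset.range n, ∑ k ∈ Finset.Ioc j n,
      ρ ^ (k - j) * ∑ e ∈ Finset.Ico j k, d e = ∑ e ∈ Finset.range n,
        ∑ j ∈ Finset.range (e + 1), ∑ k ∈ Finset.Ioc e n, ρ ^ (k - j) * d e := by
    simp only [Finset.mul_sum]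
    have h1 : ∀ j ∈ Finset.range n, ∑ k ∈ Finset.Ioc j n, ∑ e ∈ Finset.Ico j k,
        ρ ^ (k - j) * d e = ∑ e ∈ Finset.Ico j n, ∑ k ∈ Finset.Ioc e n, ρ ^ (k - j) * d e := by
      intro j _
      refine Finset.sum_comm' ?_
      intro k e
      simp only [Finset.mem_Ioc, Finset.mem_Ico]
      omega
    rw [Finset.sum_congr rfl h1]
    refine Finset.sum_comm' ?_
    intro j e
    simp only [Finset.mem_range, Finset.mem_Ico]
    omega
  rw [hswap, Finset.mul_sum]
  refine Finset.sum_le_sum fun e he => ?_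
  rw [Finset.mem_range] at he
  simp only [← Finset.sum_mul]
  refine mul_le_mul_of_nonneg_right ?_ (hd e he)
  have h2 : ∑ j ∈ Finset.range (e + 1), ∑ k ∈ Finset.Ioc e n, ρ ^ (k - j) =
      (∑ j ∈ Finset.range (e + 1), ρ ^ (e - j)) * ∑ k ∈ Finset.Ioc e n, ρ ^ (k - e) := by
    rw [Finset.sum_mul_sum]
    refine Finset.sum_congr rfl fun j hj => Finset.sum_congr rfl fun k hk => ?_
    rw [Finset.mem_range] at hj
    rw [Finset.mem_Ioc] at hk
    rw [← pow_add]
    congr 1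
    omega
  have h3 : ∑ j ∈ Finset.range (e + 1), ρ ^ (e - j) ≤ (1 - ρ)⁻¹ := by
    have := Finset.sum_range_reflect (fun i => ρ ^ i) (e + 1)
    simp only [Nat.add_sub_cancel] at this
    rw [this]
    exact hgeo _
  have h4 : ∑ k ∈ Finset.Ioc e n, ρ ^ (k - e) ≤ (1 - ρ)⁻¹ := by
    rw [← Finset.Ico_add_one_add_one_eq_Ioc, Finset.sum_Ico_eq_sum_range]
    refine le_trans (Finset.sum_le_sum fun i _ => ?_) (hgeo _)
    exact pow_le_pow_of_le_one hρ0 hρ1.le (by omega)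
  rw [h2, sq]
  exact mul_le_mul h3 h4 (Finset.sum_nonneg fun _ _ => pow_nonneg hρ0 _) hinv

theorem exists_sum_pow_mul_chain_le {θ K : ℝ} (hθ0 : 0 < θ) (hθ1 : θ < 1) (hK : 1 ≤ K) :
    ∃ C : ℝ, 0 ≤ C ∧ ∀ (n : ℕ) (D : ℕ → ℕ → ℝ),
      (∀ i j, i ≤ n → j ≤ n → 0 ≤ D i j) →
      (∀ i j k, i < j → j < k → k ≤ n → D i k ≤ K * (D i j + D j k)) →
      ∑ j ∈ Finset.range n, ∑ k ∈ Finset.Ioc j n, θ ^ (k - j - 1) * D j k ≤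
        C * ∑ e ∈ Finset.range n, D e (e + 1) := by
  obtain ⟨C, ρ, hC, hρ0, hρ1, h⟩ := exists_pow_mul_chain_le hθ0 hθ1 hK
  refine ⟨C * (1 - ρ)⁻¹ ^ 2, by positivity, fun n D hD htri => ?_⟩
  have h2 := mul_le_mul_of_nonneg_left (sum_pow_mul_sum_Ico_le hρ0 hρ1
    (d := fun e => D e (e + 1)) (n := n) fun e he => hD _ _ he.le he) hC
  rw [← mul_assoc] at h2
  refine le_trans ?_ h2
  rw [Finset.mul_sum]
  refine Finset.sum_le_sum fun j _ => ?_
  rw [Finset.mul_sum]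
  refine Finset.sum_le_sum fun k hk => ?_
  rw [Finset.mem_Ioc] at hk
  exact h n D hD htri j k hk.1 hk.2

end ChainEstimates

section MovingParticle

theorem sum_powerset_prod_disjoint {I J : Finset ℕ} (hJ : J ⊆ I) (p : ℕ → ℝ) :
    ∑ U ∈ I.powerset, (if Disjoint U J then (∏ i ∈ U, p i) * ∏ i ∈ I \ U, (1 - p i) else 0) =
      ∏ i ∈ J, (1 - p i) := by
  rw [← Finset.sum_filter]
  have h1 : I.powerset.filter (fun U => Disjoint U J) = (I \ J).powerset := by
    ext U
    rw [Finset.mem_filter, Finset.mem_powerset, Finset.mem_powerset, Finset.subset_sdiff]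
  have h2 : ∀ U ∈ (I \ J).powerset, (∏ i ∈ U, p i) * ∏ i ∈ I \ U, (1 - p i) =
      (∏ i ∈ J, (1 - p i)) * ((∏ i ∈ U, p i) * ∏ i ∈ (I \ J) \ U, (1 - p i)) := by
    intro U hU
    rw [Finset.mem_powerset, Finset.subset_sdiff] at hU
    have e : I \ U = J ∪ ((I \ J) \ U) := by
      ext t
      have h4 : t ∈ J → t ∈ I := fun h => hJ h
      have h3 : t ∈ U → t ∉ J := fun h => Finset.disjoint_left.1 hU.2 h
      simp only [Finset.mem_sdiff, Finset.mem_union]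
      tauto
    have hdis : Disjoint J ((I \ J) \ U) := by
      rw [Finset.disjoint_left]
      intro t ht ht'
      exact (Finset.mem_sdiff.1 (Finset.mem_sdiff.1 ht').1).2 ht
    rw [e, Finset.prod_union hdis]
    ring
  rw [h1, Finset.sum_congr rfl h2, ← Finset.mul_sum, ← Finset.prod_add]
  simp

variable {V : Type*} [DecidableEq V]

/-- The probability of declaring the site `z` free given the configuration `S`; it exactly
compensates the weight of the field at `z`. -/
def freeProb (α : V → ℝ) (B : ℝ) (z : V) (S : Finset V) : ℝ :=
  if z ∈ S then Real.exp (-B - α z) else Real.exp (-B)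

theorem freeProb_bounds {α : V → ℝ} {B : ℝ} (hB : 0 ≤ B) {z : V} (hz : |α z| ≤ B)
    (S : Finset V) : Real.exp (-(2 * B)) ≤ freeProb α B z S ∧ freeProb α B z S ≤ 1 := by
  rw [abs_le] at hz
  unfold freeProb
  split_ifs <;> constructor
  · exact Real.exp_le_exp.2 (by linarith)
  · exact Real.exp_le_one_iff.2 (by linarith)
  · exact Real.exp_le_exp.2 (by linarith)
  · exact Real.exp_le_one_iff.2 (by linarith)

theorem canWeight_mul_prod_freeProb (α : V → ℝ) (B : ℝ) (G S : Finset V) :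
    canWeight α S * ∏ z ∈ G, freeProb α B z S =
      Real.exp (-B) ^ G.card * canWeight α (S \ G) := by
  have h : ∀ z ∈ G, freeProb α B z S = Real.exp (-B) * (if z ∈ S then Real.exp (-α z) else 1) := by
    intro z _
    unfold freeProb
    split_ifs
    · rw [← Real.exp_add, sub_eq_add_neg]
    · rw [mul_one]
  rw [Finset.prod_congr rfl h, Finset.prod_mul_distrib, Finset.prod_const, mul_left_comm]
  congr 1
  rw [Finset.prod_ite_mem, ← Real.exp_sum]
  unfold canWeight
  rw [← Real.exp_add, ← Finset.sum_sdiff (Finset.inter_subset_left : S ∩ G ⊆ S),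
    Finset.sdiff_inter_self_left, Finset.inter_comm G S, Finset.sum_neg_distrib, add_neg_cancel_right]

theorem exchV_sdiff_of_mem {G : Finset V} {x y : V} (hx : x ∈ G) (hy : y ∈ G) (S : Finset V) :
    exchV x y S \ G = S \ G := by
  ext t
  simp only [mem_exchV, Finset.mem_sdiff]
  grind

/-- The joint weight of the configuration `S` and the set of free sites among the
`γ i`, `i ≤ n`, being exactly the image of `F`. -/
def freeWeight (α : V → ℝ) (B : ℝ) (γ : ℕ → V) (n : ℕ) (F : Finset ℕ) (S : Finset V) : ℝ :=
  canWeight α S * ((∏ i ∈ F, freeProb α B (γ i) S) *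
    ∏ i ∈ Finset.range (n + 1) \ F, (1 - freeProb α B (γ i) S))

theorem freeWeight_nonneg {α : V → ℝ} {B : ℝ} (hB : 0 ≤ B) {γ : ℕ → V} {n : ℕ}
    (hα : ∀ i ≤ n, |α (γ i)| ≤ B) {F : Finset ℕ} (hF : F ⊆ Finset.range (n + 1))
    (S : Finset V) : 0 ≤ freeWeight α B γ n F S := by
  refine mul_nonneg (canWeight_pos α S).le (mul_nonneg (Finset.prod_nonneg fun i hi => ?_)
    (Finset.prod_nonneg fun i hi => ?_))
  · exact (Real.exp_pos _).le.trans
      (freeProb_bounds hB (hα i (Finset.mem_range_succ_iff.1 (hF hi))) S).1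
  · exact sub_nonneg.2 (freeProb_bounds hB
      (hα i (Finset.mem_range_succ_iff.1 (Finset.mem_sdiff.1 hi).1)) S).2

theorem freeWeight_exchV {α : V → ℝ} {B : ℝ} {γ : ℕ → V} {n : ℕ}
    (hγ : Set.InjOn γ (Set.Iic n)) {F : Finset ℕ} (hF : F ⊆ Finset.range (n + 1)) {j k : ℕ}
    (hj : j ∈ F) (hk : k ∈ F) (S : Finset V) :
    freeWeight α B γ n F (exchV (γ j) (γ k) S) = freeWeight α B γ n F S := by
  have hle : ∀ {i}, i ∈ F → i ≤ n := fun hi => Finset.mem_range_succ_iff.1 (hF hi)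
  have hprod : ∀ S, canWeight α S * ∏ i ∈ F, freeProb α B (γ i) S =
      Real.exp (-B) ^ (F.image γ).card * canWeight α (S \ F.image γ) := by
    intro S
    rw [← canWeight_mul_prod_freeProb, Finset.prod_image]
    exact fun a ha b hb h => hγ (hle ha) (hle hb) h
  unfold freeWeight
  rw [← mul_assoc, ← mul_assoc, hprod, hprod, exchV_sdiff_of_mem
    (Finset.mem_image_of_mem γ hj) (Finset.mem_image_of_mem γ hk)]
  congr 1
  refine Finset.prod_congr rfl fun i hi => ?_
  rw [Finset.mem_sdiff, Finset.mem_range_succ_iff] at hi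
  have ne : ∀ m ∈ F, γ i ≠ γ m := by
    intro m hm h
    rw [hγ hi.1 (hle hm) h] at hi
    exact hi.2 hm
  unfold freeProb
  simp only [mem_exchV, Equiv.swap_apply_of_ne_of_ne (ne j hj) (ne k hk)]

theorem exchForm_freeWeight_le {Λ : Finset V} {N : ℕ} {α : V → ℝ} {B : ℝ} (hB : 0 ≤ B)
    {γ : ℕ → V} {n : ℕ} (hn : 0 < n) (hα : ∀ i ≤ n, |α (γ i)| ≤ B)
    (hγ : Set.InjOn γ (Set.Iic n)) (hγΛ : ∀ i ≤ n, γ i ∈ Λ) {F : Finset ℕ}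
    (hF : F ⊆ Finset.range (n + 1)) (h0 : 0 ∈ F) (hnF : n ∈ F) (f : Finset V → ℝ) :
    exchForm Λ N (freeWeight α B γ n F) f (γ 0) (γ n) ≤
      4 * n * ∑ j ∈ Finset.range n, ∑ k ∈ Finset.Ioc j n, open Classical in
        if IsGap F j k then exchForm Λ N (freeWeight α B γ n F) f (γ j) (γ k) else 0 := by
  have hle : ∀ {i}, i ∈ F → i ≤ n := fun hi => Finset.mem_range_succ_iff.1 (hF hi)
  have hw0 : ∀ S ∈ Λ.powersetCard N, 0 ≤ freeWeight α B γ n F S :=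
    fun S _ => freeWeight_nonneg hB hα hF S
  have h := chain_le_sum_gap (D := fun j k => exchForm Λ N (freeWeight α B γ n F) f (γ j) (γ k))
    hnF (fun i _ j _ => exchForm_nonneg _ _ _ _ _ _ hw0)
    (fun i hi j hj _ _ r hr => by
      have := exchForm_triangle (hγΛ i (hle hi)) (hγΛ j (hle hj)) (hγΛ n le_rfl) f le_rfl hr hw0
        (fun S _ => by rw [freeWeight_exchV hγ hF hi hj, one_mul])
        (fun S _ => by rw [freeWeight_exchV hγ hF hj hnF, one_mul])
      norm_num at this
      exact this) (n - 1) 0 h0 (by omega)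
  rw [Nat.cast_zero, sub_zero, ← Finset.range_eq_Ico] at h
  exact h

theorem sum_freeWeight (α : V → ℝ) (B : ℝ) (γ : ℕ → V) {n : ℕ} (hn : 0 < n) {J : Finset ℕ}
    (hJ : J ⊆ Finset.Ioo 0 n) (S : Finset V) :
    ∑ U ∈ (Finset.Ioo 0 n).powerset,
      (if Disjoint U J then freeWeight α B γ n (insert 0 (insert n U)) S else 0) =
    canWeight α S * (freeProb α B (γ 0) S * freeProb α B (γ n) S *
      ∏ i ∈ J, (1 - freeProb α B (γ i) S)) := by
  rw [← sum_powerset_prod_disjoint hJ, Finset.mul_sum, Finset.mul_sum]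
  refine Finset.sum_congr rfl fun U hU => ?_
  rw [Finset.mem_powerset] at hU
  split_ifs
  · have hU0 : n ∉ U := fun h => by simpa using hU h
    have hUn : 0 ∉ insert n U := by
      rw [Finset.mem_insert, not_or]
      exact ⟨hn.ne, fun h => by simpa using hU h⟩
    have e : Finset.range (n + 1) \ insert 0 (insert n U) = Finset.Ioo 0 n \ U := by
      ext t
      simp only [Finset.mem_sdiff, Finset.mem_insert, Finset.mem_range, Finset.mem_Ioo]
      by_cases ht : t ∈ U <;> simp [ht]
      omega
    unfold freeWeight
    rw [e, Finset.prod_insert hUn, Finset.prod_insert hU0]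
    ring
  · simp

theorem exists_movingParticle {B : ℝ} (hB : 0 < B) : ∃ C : ℝ, 0 ≤ C ∧
    ∀ (V : Type) [DecidableEq V] (Λ : Finset V) (N : ℕ) (α : V → ℝ) (γ : ℕ → V) (n : ℕ)
      (f : Finset V → ℝ), (∀ x ∈ Λ, |α x| ≤ B) → (∀ i ≤ n, γ i ∈ Λ) →
      Set.InjOn γ (Set.Iic n) →
      exchForm Λ N (canWeight α) f (γ 0) (γ n) ≤
        C * n * ∑ i ∈ Finset.range n, exchForm Λ N (canWeight α) f (γ i) (γ (i + 1)) := by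
  classical
  have hK1 : 1 ≤ 8 * Real.exp (4 * B) := by
    have := Real.one_le_exp (x := 4 * B) (by linarith)
    linarith
  have hθ1 : 1 - Real.exp (-(2 * B)) < 1 := by linarith [Real.exp_pos (-(2 * B))]
  have hθ0 : 0 < 1 - Real.exp (-(2 * B)) := by
    rw [sub_pos, Real.exp_lt_one_iff]; linarith
  obtain ⟨C, hC, hchain⟩ := exists_sum_pow_mul_chain_le hθ0 hθ1 hK1
  set θ := 1 - Real.exp (-(2 * B)) with hθ
  set q := Real.exp (-(2 * B)) with hq
  have hq0 : 0 < q := Real.exp_pos _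
  refine ⟨4 * C / q ^ 2, by positivity, fun V _ Λ N α γ n f hαΛ hγΛ hγ => ?_⟩
  rcases Nat.eq_zero_or_pos n with rfl | hn
  · simp [exchForm_self]
  have hα : ∀ i ≤ n, |α (γ i)| ≤ B := fun i hi => hαΛ _ (hγΛ i hi)
  set D : ℕ → ℕ → ℝ := fun j k => exchForm Λ N (canWeight α) f (γ j) (γ k) with hD
  have hD0 : ∀ j k, 0 ≤ D j k := fun j k =>
    exchForm_nonneg _ _ _ _ _ _ fun S _ => (canWeight_pos α S).le
  set φ : Finset ℕ → Finset ℕ := fun U => insert 0 (insert n U) with hφ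
  set I := Finset.Ioo 0 n with hI
  have hφr : ∀ U ∈ I.powerset, φ U ⊆ Finset.range (n + 1) := by
    intro U hU t ht
    rw [Finset.mem_powerset] at hU
    rw [Finset.mem_range]
    simp only [hφ, Finset.mem_insert] at ht
    rcases ht with rfl | rfl | ht
    · omega
    · omega
    · have := Finset.mem_Ioo.1 (hU ht)
      omega
  have hpq : ∀ i ≤ n, ∀ S, q ≤ freeProb α B (γ i) S ∧ freeProb α B (γ i) S ≤ 1 :=
    fun i hi S => freeProb_bounds hB.le (hα i hi) S
  have hlower : q ^ 2 * D 0 n ≤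
      ∑ U ∈ I.powerset, exchForm Λ N (freeWeight α B γ n (φ U)) f (γ 0) (γ n) := by
    simp only [hD, exchForm]
    rw [Finset.sum_comm, Finset.mul_sum]
    refine Finset.sum_le_sum fun S _ => ?_
    rw [← Finset.sum_mul, ← mul_assoc]
    refine mul_le_mul_of_nonneg_right ?_ (sq_nonneg _)
    have := sum_freeWeight α B γ hn (Finset.empty_subset I) S
    simp only [Finset.disjoint_empty_right, if_true, Finset.prod_empty, mul_one] at this
    rw [this, mul_comm, sq]
    exact mul_le_mul_of_nonneg_left (mul_le_mul (hpq 0 hn.le S).1 (hpq n le_rfl S).1 hq0.le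
      (hq0.le.trans (hpq 0 hn.le S).1)) (canWeight_pos α S).le
  have hupper : ∀ j k, j < k → k ≤ n → ∑ U ∈ I.powerset,
      (if IsGap (φ U) j k then exchForm Λ N (freeWeight α B γ n (φ U)) f (γ j) (γ k) else 0) ≤
      θ ^ (k - j - 1) * D j k := by
    intro j k hjk hk
    have hJ : Finset.Ioo j k ⊆ I := Finset.Ioo_subset_Ioo (Nat.zero_le _) hk
    calc _ ≤ ∑ U ∈ I.powerset, ∑ S ∈ Λ.powersetCard N, (if Disjoint U (Finset.Ioo j k) then
          freeWeight α B γ n (φ U) S else 0) * gradV (γ j) (γ k) f S ^ 2 := ?_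
      _ = ∑ S ∈ Λ.powersetCard N, (canWeight α S * (freeProb α B (γ 0) S * freeProb α B (γ n) S *
          ∏ i ∈ Finset.Ioo j k, (1 - freeProb α B (γ i) S))) * gradV (γ j) (γ k) f S ^ 2 := by
          rw [Finset.sum_comm]
          refine Finset.sum_congr rfl fun S _ => ?_
          rw [← Finset.sum_mul, ← sum_freeWeight α B γ hn hJ S]
      _ ≤ _ := ?_
    · refine Finset.sum_le_sum fun U hU => ?_
      have hnn : ∀ S, 0 ≤ freeWeight α B γ n (φ U) S :=
        fun S => freeWeight_nonneg hB.le hα (hφr U hU) S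
      split_ifs with h1 h2 h2
      · exact le_rfl
      · refine absurd (h1.2.2.2.mono_left ?_) h2
        exact (Finset.subset_insert _ _).trans (Finset.subset_insert _ _)
      · exact Finset.sum_nonneg fun S _ => mul_nonneg (hnn S) (sq_nonneg _)
      · simp
    · simp only [hD, exchForm]
      rw [Finset.mul_sum]
      refine Finset.sum_le_sum fun S _ => ?_
      rw [← mul_assoc (θ ^ (k - j - 1))]
      refine mul_le_mul_of_nonneg_right ?_ (sq_nonneg _)
      rw [mul_comm]
      refine mul_le_mul_of_nonneg_right ?_ (canWeight_pos α S).le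
      have h1 : ∏ i ∈ Finset.Ioo j k, (1 - freeProb α B (γ i) S) ≤ θ ^ (k - j - 1) := by
        rw [← Nat.card_Ioo, ← Finset.prod_const]
        refine Finset.prod_le_prod (fun i hi => ?_) fun i hi => ?_ <;>
          rw [Finset.mem_Ioo] at hi
        · linarith [(hpq i (by omega) S).2]
        · linarith [(hpq i (by omega) S).1]
      have h2 : 0 ≤ ∏ i ∈ Finset.Ioo j k, (1 - freeProb α B (γ i) S) := by
        refine Finset.prod_nonneg fun i hi => ?_
        rw [Finset.mem_Ioo] at hi
        linarith [(hpq i (by omega) S).2]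
      have h3 : freeProb α B (γ 0) S * freeProb α B (γ n) S ≤ 1 :=
        mul_le_one₀ (hpq 0 hn.le S).2 (hq0.le.trans (hpq n le_rfl S).1) (hpq n le_rfl S).2
      exact (mul_le_of_le_one_left h2 h3).trans h1
  have hmid : ∑ U ∈ I.powerset, exchForm Λ N (freeWeight α B γ n (φ U)) f (γ 0) (γ n) ≤
      4 * n * ∑ j ∈ Finset.range n, ∑ k ∈ Finset.Ioc j n, θ ^ (k - j - 1) * D j k := by
    calc _ ≤ ∑ U ∈ I.powerset, 4 * (n : ℝ) * ∑ j ∈ Finset.range n, ∑ k ∈ Finset.Ioc j n,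
          if IsGap (φ U) j k then exchForm Λ N (freeWeight α B γ n (φ U)) f (γ j) (γ k) else 0 :=
          Finset.sum_le_sum fun U hU => exchForm_freeWeight_le hB.le hn hα hγ hγΛ (hφr U hU)
            (by simp [hφ]) (by simp [hφ]) f
      _ = 4 * (n : ℝ) * ∑ j ∈ Finset.range n, ∑ k ∈ Finset.Ioc j n, ∑ U ∈ I.powerset,
          if IsGap (φ U) j k then exchForm Λ N (freeWeight α B γ n (φ U)) f (γ j) (γ k)
            else 0 := by
          rw [← Finset.mul_sum, Finset.sum_comm]
          congr 1
          exact Finset.sum_congr rfl fun j _ => Finset.sum_comm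
      _ ≤ _ := by
          refine mul_le_mul_of_nonneg_left ?_ (by positivity)
          refine Finset.sum_le_sum fun j _ => Finset.sum_le_sum fun k hk => ?_
          rw [Finset.mem_Ioc] at hk
          exact hupper j k hk.1 hk.2
  have hch := hchain n D (fun i j _ _ => hD0 i j) fun i j k hij hjk hk =>
    exchForm_canWeight_triangle hB.le hαΛ f (hγΛ i (by omega)) (hγΛ j (by omega)) (hγΛ k hk)
  have hall := (hlower.trans hmid).trans (mul_le_mul_of_nonneg_left hch (by positivity))
  change D 0 n ≤ _
  calc D 0 n = q ^ 2 * D 0 n / q ^ 2 := by field_simp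
    _ ≤ (4 * n * (C * ∑ e ∈ Finset.range n, D e (e + 1))) / q ^ 2 :=
      div_le_div_of_nonneg_right hall (by positivity)
    _ = _ := by ring

end MovingParticle

section Cube

variable {d : ℕ}

theorem mem_cube {v x : Fin d → ℤ} {L : ℕ} :
    x ∈ cube d v L ↔ ∀ i, v i ≤ x i ∧ x i < v i + L := by
  simp [cube]

theorem card_cube (v : Fin d → ℤ) (L : ℕ) : (cube d v L).card = L ^ d := by
  simp [cube]

theorem update_mem_cube {v x : Fin d → ℤ} {L : ℕ} (hx : x ∈ cube d v L) {k : Fin d} {s : ℤ}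
    (hs : s ∈ Finset.Ico (v k) (v k + L)) : Function.update x k s ∈ cube d v L := by
  rw [Finset.mem_Ico] at hs
  rw [mem_cube] at hx ⊢
  intro i
  by_cases h : i = k
  · subst h
    simpa using hs
  · rw [Function.update_of_ne h]
    exact hx i

theorem sum_cube_update (v : Fin d → ℤ) (L : ℕ) (k : Fin d) (h : (Fin d → ℤ) → ℝ) :
    ∑ u ∈ cube d v L, ∑ s ∈ Finset.Ico (v k) (v k + L), h (Function.update u k s) =
      L * ∑ u ∈ cube d v L, h u := by
  have hcoord : ∀ u ∈ cube d v L, u k ∈ Finset.Ico (v k) (v k + L) := fun u hu => by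
    rw [Finset.mem_Ico]; exact mem_cube.1 hu k
  have mem : ∀ p ∈ cube d v L ×ˢ Finset.Ico (v k) (v k + (L : ℤ)),
      (Function.update p.1 k p.2, p.1 k) ∈
        cube d v L ×ˢ Finset.Ico (v k) (v k + (L : ℤ)) := by
    intro p hp
    rw [Finset.mem_product] at hp
    exact Finset.mem_product.2 ⟨update_mem_cube hp.1 hp.2, hcoord _ hp.1⟩
  rw [← Finset.sum_product' (cube d v L) (Finset.Ico (v k) (v k + (L : ℤ)))
    (fun u s => h (Function.update u k s))]
  rw [Finset.sum_nbij' (t := cube d v L ×ˢ Finset.Ico (v k) (v k + (L : ℤ)))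
    (g := fun p => h p.1) (fun p => (Function.update p.1 k p.2, p.1 k))
    (fun p => (Function.update p.1 k p.2, p.1 k)) mem mem (by simp) (by simp) (by simp)]
  rw [Finset.sum_product_right]
  simp

/-- The site whose coordinates below `k` are those of `y` and the others those of `x`. -/
def mixV (k : ℕ) (x y : Fin d → ℤ) : Fin d → ℤ := fun i => if (i : ℕ) < k then y i else x i

theorem mixV_mem_cube {v x y : Fin d → ℤ} {L : ℕ} (hx : x ∈ cube d v L) (hy : y ∈ cube d v L)
    (k : ℕ) : mixV k x y ∈ cube d v L := by
  rw [mem_cube] at *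
  intro i
  unfold mixV
  split_ifs
  · exact hy i
  · exact hx i

theorem mixV_succ (k : Fin d) (x y : Fin d → ℤ) :
    mixV (k + 1) x y = Function.update (mixV k x y) k (mixV k y x k) := by
  ext i
  by_cases h : i = k
  · subst h
    simp [mixV]
  · rw [Function.update_of_ne h]
    have : (i : ℕ) ≠ k := fun h' => h (Fin.ext h')
    unfold mixV
    congr 1
    rw [eq_iff_iff]
    omega

theorem sum_cube_mixV (v : Fin d → ℤ) (L k : ℕ) (h : (Fin d → ℤ) → (Fin d → ℤ) → ℝ) :
    ∑ x ∈ cube d v L, ∑ y ∈ cube d v L, h (mixV k x y) (mixV k y x) =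
      ∑ x ∈ cube d v L, ∑ y ∈ cube d v L, h x y := by
  have inv : ∀ x y : Fin d → ℤ, mixV k (mixV k x y) (mixV k y x) = x := by
    intro x y
    ext i
    simp only [mixV]
    split_ifs <;> rfl
  have mem : ∀ p ∈ cube d v L ×ˢ cube d v L,
      (mixV k p.1 p.2, mixV k p.2 p.1) ∈ cube d v L ×ˢ cube d v L := by
    intro p hp
    rw [Finset.mem_product] at hp ⊢
    exact ⟨mixV_mem_cube hp.1 hp.2 k, mixV_mem_cube hp.2 hp.1 k⟩
  rw [← Finset.sum_product', ← Finset.sum_product']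
  refine Finset.sum_nbij' (fun p => (mixV k p.1 p.2, mixV k p.2 p.1))
    (fun p => (mixV k p.1 p.2, mixV k p.2 p.1)) mem mem ?_ ?_ fun _ _ => rfl
  · intro p _
    simp [inv]
  · intro p _
    simp [inv]

/-- The unnormalised nearest-neighbour Dirichlet form on the cube. -/
def nnForm (v : Fin d → ℤ) (L N : ℕ) (α : (Fin d → ℤ) → ℝ) (f : Finset (Fin d → ℤ) → ℝ) : ℝ :=
  ∑ x ∈ cube d v L, ∑ y ∈ cube d v L,
    if (∑ i, |x i - y i|) = 1 then exchForm (cube d v L) N (canWeight α) f x y else 0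

theorem exchForm_canWeight_nonneg {V : Type*} [DecidableEq V] (Λ : Finset V) (N : ℕ) (α : V → ℝ)
    (f : Finset V → ℝ) (x y : V) : 0 ≤ exchForm Λ N (canWeight α) f x y :=
  exchForm_nonneg _ _ _ _ _ _ fun S _ => (canWeight_pos α S).le

theorem sum_bond_le_nnForm (v : Fin d → ℤ) (L N : ℕ) (α : (Fin d → ℤ) → ℝ)
    (f : Finset (Fin d → ℤ) → ℝ) (k : Fin d) :
    ∑ u ∈ cube d v L, (if Function.update u k (u k + 1) ∈ cube d v L then
      exchForm (cube d v L) N (canWeight α) f u (Function.update u k (u k + 1)) else 0) ≤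
      nnForm v L N α f := by
  refine Finset.sum_le_sum fun u hu => ?_
  have hnn : ∀ y ∈ cube d v L, 0 ≤ if (∑ i, |u i - y i|) = 1 then
      exchForm (cube d v L) N (canWeight α) f u y else 0 := by
    intro y _
    split_ifs
    · exact exchForm_canWeight_nonneg _ _ _ _ _ _
    · exact le_rfl
  split_ifs with h
  · refine le_trans (le_of_eq ?_) (Finset.single_le_sum hnn h)
    rw [if_pos]
    rw [Finset.sum_eq_single k]
    · simp
    · intro i _ hi
      rw [Function.update_of_ne hi]
      simp
    · simp
  · exact Finset.sum_nonneg hnn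

theorem exists_exchForm_update_le {B : ℝ} (hB : 0 < B) : ∃ C : ℝ, 0 ≤ C ∧
    ∀ (L : ℕ) (v : Fin d → ℤ) (α : (Fin d → ℤ) → ℝ), (∀ x ∈ cube d v L, |α x| ≤ B) →
      ∀ (N : ℕ) (f : Finset (Fin d → ℤ) → ℝ) (k : Fin d), ∀ u ∈ cube d v L,
      ∀ t ∈ Finset.Ico (v k) (v k + (L : ℤ)),
      exchForm (cube d v L) N (canWeight α) f u (Function.update u k t) ≤
        C * L * ∑ s ∈ Finset.Ico (v k) (v k + (L : ℤ)),
          if Function.update u k (s + 1) ∈ cube d v L then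
            exchForm (cube d v L) N (canWeight α) f (Function.update u k s)
              (Function.update u k (s + 1)) else 0 := by
  obtain ⟨C, hC, hmove⟩ := exists_movingParticle hB
  refine ⟨C, hC, fun L v α hα N f k u hu t ht => ?_⟩
  have hcoord : u k ∈ Finset.Ico (v k) (v k + (L : ℤ)) := by
    rw [Finset.mem_Ico]; exact mem_cube.1 hu k
  set T := ∑ s ∈ Finset.Ico (v k) (v k + (L : ℤ)),
          if Function.update u k (s + 1) ∈ cube d v L then
            exchForm (cube d v L) N (canWeight α) f (Function.update u k s)
              (Function.update u k (s + 1)) else 0 with hT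
  have hnn : ∀ s, 0 ≤ if Function.update u k (s + 1) ∈ cube d v L then
            exchForm (cube d v L) N (canWeight α) f (Function.update u k s)
              (Function.update u k (s + 1)) else 0 := by
    intro s
    split_ifs
    · exact exchForm_canWeight_nonneg _ _ _ _ _ _
    · exact le_rfl
  have main : ∀ (a : ℤ) (n : ℕ), v k ≤ a → a + n < v k + L →
      exchForm (cube d v L) N (canWeight α) f (Function.update u k a)
        (Function.update u k (a + n)) ≤ C * L * T := by
    intro a n ha han
    have hmem : ∀ i : ℕ, i ≤ n → Function.update u k (a + i) ∈ cube d v L := by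
      intro i hi
      refine update_mem_cube hu ?_
      rw [Finset.mem_Ico]
      omega
    have hinj : Set.InjOn (fun i : ℕ => Function.update u k (a + i)) (Set.Iic n) := by
      intro i _ j _ hij
      have := congrFun hij k
      simpa using this
    have h := hmove _ (cube d v L) N α (fun i => Function.update u k (a + i)) n f hα hmem hinj
    simp only [Nat.cast_zero, add_zero] at h
    refine h.trans ?_
    have hsum : ∑ i ∈ Finset.range n, exchForm (cube d v L) N (canWeight α) f
        (Function.update u k (a + i)) (Function.update u k (a + (i + 1 : ℕ))) ≤ T := by
      have himg : (Finset.range n).image (fun i : ℕ => a + (i : ℤ)) ⊆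
          Finset.Ico (v k) (v k + (L : ℤ)) := by
        intro s hs
        rw [Finset.mem_image] at hs
        obtain ⟨i, hi, rfl⟩ := hs
        rw [Finset.mem_range] at hi
        rw [Finset.mem_Ico]
        omega
      refine le_trans (le_of_eq ?_)
        (Finset.sum_le_sum_of_subset_of_nonneg himg fun s _ _ => hnn s)
      rw [Finset.sum_image (fun i _ j _ hij => by simpa using hij)]
      refine Finset.sum_congr rfl fun i hi => ?_
      rw [Finset.mem_range] at hi
      have e : a + ((i + 1 : ℕ) : ℤ) = a + i + 1 := by push_cast; ring
      have := hmem (i + 1) hi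
      rw [e] at this ⊢
      rw [if_pos this]
    have hT0 : 0 ≤ T := Finset.sum_nonneg fun s _ => hnn s
    have hnL : (n : ℝ) ≤ L := by exact_mod_cast (by omega : n ≤ L)
    calc _ ≤ C * n * T := mul_le_mul_of_nonneg_left hsum (by positivity)
      _ ≤ C * L * T := by gcongr
  rw [Finset.mem_Ico] at ht hcoord
  rcases le_total (u k) t with h | h
  · have := main (u k) (t - u k).toNat hcoord.1 (by omega)
    rwa [Function.update_eq_self, Int.toNat_of_nonneg (by omega), add_sub_cancel] at this
  · have := main t (u k - t).toNat ht.1 (by omega)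
    rwa [Int.toNat_of_nonneg (by omega), add_sub_cancel, Function.update_eq_self,
      exchForm_comm] at this

theorem exists_sum_exchForm_cube_le (d : ℕ) {B : ℝ} (hB : 0 < B) : ∃ C : ℝ,
    ∀ (L : ℕ) (v : Fin d → ℤ) (α : (Fin d → ℤ) → ℝ), (∀ x ∈ cube d v L, |α x| ≤ B) →
      ∀ (N : ℕ) (f : Finset (Fin d → ℤ) → ℝ),
      ∑ x ∈ cube d v L, ∑ y ∈ cube d v L, exchForm (cube d v L) N (canWeight α) f x y ≤
        C * ((L : ℝ) ^ 2 * (cube d v L).card * nnForm v L N α f) := by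
  obtain ⟨C, hC, hline⟩ := exists_exchForm_update_le (d := d) hB
  set K := 8 * Real.exp (4 * B) with hK
  have hK0 : 0 ≤ K := by positivity
  have main : ∀ k ≤ d, ∃ c : ℝ, ∀ (L : ℕ) (v : Fin d → ℤ) (α : (Fin d → ℤ) → ℝ),
      (∀ x ∈ cube d v L, |α x| ≤ B) → ∀ (N : ℕ) (f : Finset (Fin d → ℤ) → ℝ),
      ∑ x ∈ cube d v L, ∑ y ∈ cube d v L,
        exchForm (cube d v L) N (canWeight α) f x (mixV k x y) ≤
        c * ((L : ℝ) ^ 2 * (cube d v L).card * nnForm v L N α f) := by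
    intro k
    induction k with
    | zero =>
      refine fun _ => ⟨0, fun L v α _ N f => ?_⟩
      have : ∀ x y : Fin d → ℤ, mixV 0 x y = x := fun x y => by ext; simp [mixV]
      simp [this, exchForm_self]
    | succ k ih =>
      intro hk
      obtain ⟨c, hc⟩ := ih (by omega)
      refine ⟨K * (c + C), fun L v α hα N f => ?_⟩
      set kk : Fin d := ⟨k, hk⟩ with hkk
      set D := exchForm (cube d v L) N (canWeight α) f with hD
      have hstep : ∀ x y : Fin d → ℤ,
          mixV (k + 1) x y = Function.update (mixV k x y) kk (mixV k y x kk) :=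
        fun x y => mixV_succ kk x y
      have hcoord : ∀ u ∈ cube d v L, u kk ∈ Finset.Ico (v kk) (v kk + (L : ℤ)) := fun u hu => by
        rw [Finset.mem_Ico]; exact mem_cube.1 hu kk
      set h : (Fin d → ℤ) → ℝ := fun u => if Function.update u kk (u kk + 1) ∈ cube d v L then
        D u (Function.update u kk (u kk + 1)) else 0 with hh
      have hB' : ∑ x ∈ cube d v L, ∑ y ∈ cube d v L, D (mixV k x y) (mixV (k + 1) x y) ≤
          C * ((L : ℝ) ^ 2 * (cube d v L).card * nnForm v L N α f) := by
        simp only [hstep]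
        rw [sum_cube_mixV v L k (fun u w => D u (Function.update u kk (w kk)))]
        calc _ ≤ ∑ u ∈ cube d v L, ∑ _w ∈ cube d v L,
              C * L * ∑ s ∈ Finset.Ico (v kk) (v kk + (L : ℤ)), h (Function.update u kk s) := by
              refine Finset.sum_le_sum fun u hu => Finset.sum_le_sum fun w hw => ?_
              have := hline L v α hα N f kk u hu (w kk) (hcoord w hw)
              simpa [hh] using this
          _ = C * L * (cube d v L).card * (L * ∑ u ∈ cube d v L, h u) := by
              rw [← sum_cube_update]
              simp only [Finset.sum_const, nsmul_eq_mul, Finset.mul_sum]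
              refine Finset.sum_congr rfl fun u _ => Finset.sum_congr rfl fun s _ => ?_
              ring
          _ ≤ C * L * (cube d v L).card * (L * nnForm v L N α f) := by
              refine mul_le_mul_of_nonneg_left ?_ (by positivity)
              refine mul_le_mul_of_nonneg_left ?_ (by positivity)
              exact sum_bond_le_nnForm v L N α f kk
          _ = _ := by ring
      calc _ ≤ ∑ x ∈ cube d v L, ∑ y ∈ cube d v L,
            K * (D x (mixV k x y) + D (mixV k x y) (mixV (k + 1) x y)) := by
            refine Finset.sum_le_sum fun x hx => Finset.sum_le_sum fun y hy => ?_
            exact exchForm_canWeight_triangle hB.le hα f hx (mixV_mem_cube hx hy k)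
              (mixV_mem_cube hx hy (k + 1))
        _ = K * (∑ x ∈ cube d v L, ∑ y ∈ cube d v L, D x (mixV k x y) +
              ∑ x ∈ cube d v L, ∑ y ∈ cube d v L, D (mixV k x y) (mixV (k + 1) x y)) := by
            simp only [← Finset.mul_sum, Finset.sum_add_distrib]
        _ ≤ K * (c * ((L : ℝ) ^ 2 * (cube d v L).card * nnForm v L N α f) +
              C * ((L : ℝ) ^ 2 * (cube d v L).card * nnForm v L N α f)) :=
            mul_le_mul_of_nonneg_left (add_le_add (hc L v α hα N f) hB') hK0
        _ = _ := by ring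
  obtain ⟨c, hc⟩ := main d le_rfl
  have : ∀ x y : Fin d → ℤ, mixV d x y = y := fun x y => by ext i; simp [mixV]
  simp only [this] at hc
  exact ⟨c, hc⟩

end Cube

theorem stmt_5 (d : ℕ) (B : ℝ) (hB : 0 < B) :
    ∃ C : ℝ, ∀ (L : ℕ) (v : Fin d → ℤ) (α : (Fin d → ℤ) → ℝ),
      (∀ x ∈ cube d v L, |α x| ≤ B) → ∀ N : ℕ, N ≤ L ^ d → ∀ f : Finset (Fin d → ℤ) → ℝ,
        cVar (cube d v L) α N f ≤ C * (L : ℝ) ^ 2 *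
          cE (cube d v L) α N (fun S =>
            ∑ x ∈ cube d v L, ∑ y ∈ cube d v L,
              if (∑ i, |x i - y i|) = 1 then (gradV x y f S) ^ 2 else 0) := by
  obtain ⟨C, hC⟩ := exists_sum_exchForm_cube_le d hB
  refine ⟨Real.exp (2 * B) * C, fun L v α hα N hN f => ?_⟩
  rw [← card_cube v L] at hN
  set X := (cube d v L).powersetCard N with hX
  have hXne : X.Nonempty := Finset.powersetCard_nonempty.2 hN
  have hZ : 0 < ∑ S ∈ X, canWeight α S := Finset.sum_pos (fun S _ => canWeight_pos α S) hXne
  set m := cE (cube d v L) α N f with hm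
  set g : Finset (Fin d → ℤ) → ℝ := fun S => f S - m with hg
  have hm' : m * ∑ S ∈ X, canWeight α S = ∑ S ∈ X, canWeight α S * f S :=
    div_mul_cancel₀ _ hZ.ne'
  have hg0 : ∑ S ∈ X, canWeight α S * g S = 0 := by
    simp only [hg, mul_sub, Finset.sum_sub_distrib]
    rw [← hm', ← Finset.sum_mul]
    ring
  have hgrad : ∀ x y S, gradV x y g S = gradV x y f S := by
    intro x y S
    simp [gradV, hg]
  have hform : nnForm v L N α g = ∑ S ∈ X, canWeight α S * ∑ x ∈ cube d v L, ∑ y ∈ cube d v L,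
      if (∑ i, |x i - y i|) = 1 then (gradV x y f S) ^ 2 else 0 := by
    unfold nnForm
    simp only [Finset.mul_sum]
    symm
    rw [Finset.sum_comm]
    refine Finset.sum_congr rfl fun x _ => ?_
    rw [Finset.sum_comm]
    refine Finset.sum_congr rfl fun y _ => ?_
    split_ifs
    · simp only [exchForm, hgrad, hX]
    · simp
  have hvar : ∑ S ∈ X, canWeight α S * g S ^ 2 ≤
      Real.exp (2 * B) * C * (L : ℝ) ^ 2 * nnForm v L N α g := by
    have h := (meanField_poincare hα hN hg0).trans
      (mul_le_mul_of_nonneg_left (hC L v α hα N g) (Real.exp_pos _).le)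
    rcases Nat.eq_zero_or_pos (cube d v L).card with h0 | hpos
    · have hQ := Finset.card_eq_zero.1 h0
      have hN0 : N = 0 := by omega
      have hX' : X = {∅} := by rw [hX, hN0, Finset.powersetCard_zero]
      have hn0 : nnForm v L N α g = 0 := by unfold nnForm; rw [hQ]; simp
      rw [hX', Finset.sum_singleton] at hg0
      rw [hX', Finset.sum_singleton, hn0, (mul_eq_zero.1 hg0).resolve_left (canWeight_pos α ∅).ne']
      simp
    · refine le_of_mul_le_mul_left (h.trans (le_of_eq ?_)) (Nat.cast_pos.2 hpos)
      ring
  have hdiv := div_le_div_of_nonneg_right hvar hZ.le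
  rw [hform, mul_div_assoc] at hdiv
  exact hdiv
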